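/- arXiv:math/0306396 — 2 statements merged into one kernel-verified Lean document; each statement's English description precedes it below -/
import Mathlib

section
/- For a cactus A on {1,…,n} (n odd), the amplitude Y_{i,C} := ε_{i,C} · Π_{α∈C} y_α is independent of the choice of global root i ∈ {1,…,n} and of the choice of refined cactus C with A(C) = A. -/
set_option synthInstance.maxHeartbeats 1000000
set_option maxHeartbeats 1000000

noncomputable section

variable {R : Type*} [CommRing R] [Algebra ℚ R]

/-- The Grassmann algebra on anticommuting generators indexed by `ι`,
realized as the exterior algebra of the free module `ι → R`. -/
abbrev GA (R : Type*) [CommRing R] (ι : Type*) : Type _ :=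
  ExteriorAlgebra R (ι → R)

/-- The generator `χ i` of the Grassmann algebra. -/
def gaGen {R : Type*} [CommRing R] {ι : Type*} [DecidableEq ι] (i : ι) : GA R ι :=
  ExteriorAlgebra.ι R (Pi.single i 1)

/-- The odd derivation `∂/∂χ i` (left contraction with the `i`-th coordinate functional). -/
def gaDeriv {R : Type*} [CommRing R] {ι : Type*} [DecidableEq ι] (i : ι) :
    GA R ι →ₗ[R] GA R ι :=
  CliffordAlgebra.contractLeft (Q := (0 : QuadraticForm R (ι → R))) (LinearMap.proj i)

/-- Iterated Berezin integration: `bint [τ 1, …, τ p] f = ∂/∂χ_{τ 1} ∘ ⋯ ∘ ∂/∂χ_{τ p} f`. -/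
def bint {R : Type*} [CommRing R] {ι : Type*} [DecidableEq ι] :
    List ι → GA R ι → GA R ι
  | [], f => f
  | i :: t, f => gaDeriv i (bint t f)

/-- The scalar (degree-0) part of an element of the Grassmann algebra. -/
def gaCoef {R : Type*} [CommRing R] {ι : Type*} : GA R ι →ₐ[R] R :=
  ExteriorAlgebra.algebraMapInv

/-- The (terminating) exponential of an element of the augmentation ideal of the
Grassmann algebra on finitely many generators. -/
def gexp {R : Type*} [CommRing R] [Algebra ℚ R] {ι : Type*} [Fintype ι] (f : GA R ι) :
    GA R ι :=
  ∑ p ∈ Finset.range (Fintype.card ι + 1), algebraMap ℚ R (p.factorial : ℚ)⁻¹ • f ^ p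


open scoped Classical

/-- The bipartite incidence graph of a family `𝒜` of subsets of `{1,…,n}`: one part is `𝒜`,
the other is `{1,…,n}`, with an edge between `A` and `j` whenever `j ∈ A`. -/
def incGraph {n : ℕ} (𝒜 : Finset (Finset (Fin n))) :
    SimpleGraph ({A // A ∈ 𝒜} ⊕ Fin n) :=
  SimpleGraph.fromRel (fun x y =>
    match x, y with
    | Sum.inl A, Sum.inr j => j ∈ A.1
    | _, _ => False)

/-- `𝒜` is an (odd) cactus: all blocks have odd cardinality `≥ 3` and the bipartite
incidence graph is a tree (spanning all of `{1,…,n}`). -/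
def IsCactus {n : ℕ} (𝒜 : Finset (Finset (Fin n))) : Prop :=
  (∀ A ∈ 𝒜, Odd A.card ∧ 3 ≤ A.card) ∧ (incGraph 𝒜).IsTree

/-- The family of underlying blocks of a set of sequences. -/
def cactusOf {n : ℕ} (C : Finset (Σ k : ℕ, Fin k → Fin n)) : Finset (Finset (Fin n)) :=
  C.image (fun a => Finset.image a.2 Finset.univ)

/-- `C` is a refined cactus: a set of injective sequences of odd length `≥ 3`, with pairwise
distinct underlying sets, whose family of underlying sets is a cactus. -/
def RefinedCactus {n : ℕ} (C : Finset (Σ k : ℕ, Fin k → Fin n)) : Prop :=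
  (∀ a ∈ C, Odd a.1 ∧ 3 ≤ a.1 ∧ Function.Injective a.2) ∧
    Set.InjOn (fun a : Σ k : ℕ, Fin k → Fin n => Finset.image a.2 Finset.univ) ↑C ∧
    IsCactus (cactusOf C)

/-- `l` is the circulation of the sequence `a` with respect to the global root `i`:
`a μ` is the local root of the block of `a` (the unique element of the block strictly
closer to `i` than the block vertex in the incidence tree), and `l` is the cyclic shift
of `a` starting just after `μ` with `a μ` deleted. -/
def IsCirculation {n : ℕ} (𝒜 : Finset (Finset (Fin n))) (i : Fin n)
    (a : Σ k : ℕ, Fin k → Fin n) (l : List (Fin n)) : Prop :=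
  ∃ (μ : Fin a.1) (hA : Finset.image a.2 Finset.univ ∈ 𝒜),
    (incGraph 𝒜).dist (Sum.inr (a.2 μ)) (Sum.inr i) <
        (incGraph 𝒜).dist (Sum.inl ⟨_, hA⟩) (Sum.inr i) ∧
      l = List.ofFn (fun t : Fin (a.1 - 1) =>
        a.2 ⟨((μ : ℕ) + (t : ℕ) + 1) % a.1, Nat.mod_lt _ μ.pos⟩)

/-- `pl` is a listing of `{1,…,n}` obtained by concatenating the root `i` followed by the
circulations of the elements of `C`, in some order. -/
def IsCactusList {n : ℕ} (C : Finset (Σ k : ℕ, Fin k → Fin n)) (i : Fin n)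
    (pl : List (Fin n)) : Prop :=
  ∃ L : List ((Σ k : ℕ, Fin k → Fin n) × List (Fin n)),
    (L.map Prod.fst).Nodup ∧ (L.map Prod.fst).toFinset = C ∧
      (∀ x ∈ L, IsCirculation (cactusOf C) i x.1 x.2) ∧
      pl = i :: (L.map Prod.snd).flatten

/-- The permutation of `Fin n` determined by a duplicate-free listing `l` of all of `Fin n`
(the identity if `l` is not such a listing). -/
noncomputable def listPerm {n : ℕ} (l : List (Fin n)) : Equiv.Perm (Fin n) :=
  if h : l.length = n ∧ l.Nodup then
    Equiv.ofBijective (fun t => l.get (Fin.cast h.1.symm t))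
      (Finite.injective_iff_bijective.mp (fun s t hst => by
        have h2 := List.nodup_iff_injective_get.mp h.2 hst
        exact Fin.val_injective (by simpa using congrArg Fin.val h2)))
  else 1

namespace CactusAux

variable {n : ℕ}

/-- Generators over the integers. -/
def ce (j : Fin n) : GA ℤ (Fin n) := ExteriorAlgebra.ι ℤ (Pi.single j 1)

/-- Product of generators along a list. -/
def cT (l : List (Fin n)) : GA ℤ (Fin n) := (l.map ce).prod

/-- Product of differences of generators along a list. -/
def cV (r : Fin n) (l : List (Fin n)) : GA ℤ (Fin n) := (l.map (fun j => ce j - ce r)).prod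

/-- Contraction with the sum functional. -/
def cd : GA ℤ (Fin n) →ₗ[ℤ] GA ℤ (Fin n) :=
  CliffordAlgebra.contractLeft (Q := (0 : QuadraticForm ℤ (Fin n → ℤ)))
    (∑ j, LinearMap.proj j)

/-- The even element of a block. -/
def cW (a : Σ k : ℕ, Fin k → Fin n) : GA ℤ (Fin n) := cd (cT (List.ofFn a.2))

theorem ce_sub (j r : Fin n) : ce j - ce r =
    (ExteriorAlgebra.ι ℤ (Pi.single j 1 - Pi.single r 1) : GA ℤ (Fin n)) := by
  simp [ce]

theorem ce_sq (j : Fin n) : ce j * ce j = 0 := ExteriorAlgebra.ι_sq_zero _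

theorem ce_swap (i j : Fin n) : ce i * ce j = - (ce j * ce i) :=
  eq_neg_of_add_eq_zero_left (ExteriorAlgebra.ι_add_mul_swap _ _)

theorem cd_ce_mul (j : Fin n) (x : GA ℤ (Fin n)) : cd (ce j * x) = x - ce j * cd x := by
  have := CliffordAlgebra.contractLeft_ι_mul (Q := (0 : QuadraticForm ℤ (Fin n → ℤ)))
    (∑ j, LinearMap.proj j) (Pi.single j 1) x
  simp only [LinearMap.sum_apply, LinearMap.proj_apply] at this
  rw [show (∑ d, (Pi.single j 1 : Fin n → ℤ) d) = 1 by simp, one_smul] at this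
  exact this

theorem cd_one : cd (1 : GA ℤ (Fin n)) = 0 := CliffordAlgebra.contractLeft_one _ _

theorem cd_sub_mul (j r : Fin n) (x : GA ℤ (Fin n)) (hx : cd x = 0) :
    cd ((ce j - ce r) * x) = 0 := by
  rw [sub_mul, map_sub, cd_ce_mul, cd_ce_mul, hx]; simp

theorem cd_cV_mul (r : Fin n) (l : List (Fin n)) (x : GA ℤ (Fin n)) (hx : cd x = 0) :
    cd (cV r l * x) = 0 := by
  induction l with
  | nil => simpa [cV] using hx
  | cons j l ih =>
    have : cV r (j :: l) * x = (ce j - ce r) * (cV r l * x) := by simp [cV, mul_assoc]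
    rw [this]; exact cd_sub_mul _ _ _ ih

theorem ce_mul_cT (r : Fin n) (l : List (Fin n)) (h : r ∈ l) : ce r * cT l = 0 := by
  induction l with
  | nil => simp at h
  | cons j l ih =>
    have e : cT (j :: l) = ce j * cT l := by simp [cT]
    rw [e]
    by_cases hj : r = j
    · rw [hj, ← mul_assoc, ce_sq, zero_mul]
    · have : r ∈ l := by simpa [hj] using h
      rw [← mul_assoc, ce_swap, neg_mul, mul_assoc, ih this]; simp

theorem cT_append (l m : List (Fin n)) : cT (l ++ m) = cT l * cT m := by simp [cT]

theorem cT_mul_ce (r : Fin n) (l : List (Fin n)) (h : r ∈ l) : cT l * ce r = 0 := by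
  induction l using List.reverseRecOn with
  | nil => simp at h
  | append_singleton l j ih =>
    have e : cT (l ++ [j]) = cT l * ce j := by simp [cT]
    rw [e]
    by_cases hj : r = j
    · rw [hj, mul_assoc, ce_sq, mul_zero]
    · have : r ∈ l := by simpa [hj] using h
      rw [mul_assoc, ce_swap, mul_neg, ← mul_assoc, ih this]; simp

theorem cT_mul_cV (r : Fin n) (l m : List (Fin n)) (h : r ∈ l) :
    cT l * cV r m = cT (l ++ m) := by
  induction m generalizing l with
  | nil => simp [cV]
  | cons j m ih =>
    have e : cV r (j :: m) = (ce j - ce r) * cV r m := by simp [cV]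
    have e2 : cT l * (ce j - ce r) = cT (l ++ [j]) := by
      rw [mul_sub, cT_mul_ce r l h, sub_zero]; simp [cT]
    rw [e, ← mul_assoc, e2, ih _ (by simp [h])]
    simp

theorem cd_cT_cons (r : Fin n) (m : List (Fin n)) : cd (cT (r :: m)) = cV r m := by
  have h := cT_mul_cV r [r] m (by simp)
  have e : cT [r] = ce r := by simp [cT]
  have h2 : cd (cV r m) = 0 := by simpa using cd_cV_mul r m 1 cd_one
  rw [show r :: m = [r] ++ m from rfl, ← h, e, cd_ce_mul, h2]; simp

theorem comm_pair (u v : Fin n → ℤ) (x : GA ℤ (Fin n)) :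
    Commute (ExteriorAlgebra.ι ℤ u * ExteriorAlgebra.ι ℤ v) x := by
  induction x using ExteriorAlgebra.induction with
  | algebraMap r => exact (Algebra.commutes r _).symm
  | ι w =>
    have h1 := eq_neg_of_add_eq_zero_left (ExteriorAlgebra.ι_add_mul_swap (R := ℤ) v w)
    have h2 := eq_neg_of_add_eq_zero_left (ExteriorAlgebra.ι_add_mul_swap (R := ℤ) u w)
    change _ * _ = _ * _
    rw [mul_assoc, h1, mul_neg, ← mul_assoc, h2, neg_mul, neg_neg, mul_assoc]
  | mul a b ha hb => exact ha.mul_right hb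
  | add a b ha hb => exact ha.add_right hb

theorem comm_even (f : Fin n → Fin n → ℤ) : ∀ (m : ℕ) (l : List (Fin n)), l.length = 2 * m →
    ∀ x : GA ℤ (Fin n), Commute (l.map (fun j => (ExteriorAlgebra.ι ℤ (f j) : GA ℤ (Fin n)))).prod x
  | 0, l, h, x => by
    have : l = [] := by simpa using h
    subst this; simp
  | m+1, [], h, x => by simp at h
  | m+1, [_], h, x => by simp at h; omega
  | m+1, (a :: b :: l), h, x => by
    have := comm_even f m l (by simp at h; omega) x
    simp only [List.map_cons, List.prod_cons, ← mul_assoc]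
    exact (comm_pair _ _ _).mul_left this

theorem comm_cT (l : List (Fin n)) (h : Even l.length) (x : GA ℤ (Fin n)) :
    Commute (cT l) x := by
  obtain ⟨m, hm⟩ := h
  exact comm_even (fun j => Pi.single j 1) m l (by omega) x

theorem comm_cV (r : Fin n) (l : List (Fin n)) (h : Even l.length) (x : GA ℤ (Fin n)) :
    Commute (cV r l) x := by
  obtain ⟨m, hm⟩ := h
  have := comm_even (fun j => Pi.single j 1 - Pi.single r 1) m l (by omega) x
  simp only [← ce_sub] at this
  exact this

theorem cT_rotate (l : List (Fin n)) (h : Odd l.length) (k : ℕ) : cT (l.rotate k) = cT l := by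
  induction k with
  | zero => simp
  | succ k ih =>
    rw [← List.rotate_rotate, ← ih]
    have hl : Odd (l.rotate k).length := by simpa using h
    generalize l.rotate k = m at hl
    match m, hl with
    | j :: m, hl =>
      have : Even m.length := by
        simp only [List.length_cons] at hl
        rcases Nat.even_or_odd m.length with h | h
        · exact h
        · exact absurd hl (by simpa using h.add_one)
      rw [List.rotate_cons_succ, List.rotate_zero, cT_append]
      have e1 : cT [j] = ce j := by simp [cT]
      have e2 : cT (j :: m) = ce j * cT m := by simp [cT]
      rw [e1, e2]; exact comm_cT m this _

/-- The circulation list. -/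
def circ (a : Σ k : ℕ, Fin k → Fin n) (μ : Fin a.1) : List (Fin n) :=
  List.ofFn (fun t : Fin (a.1 - 1) =>
        a.2 ⟨((μ : ℕ) + (t : ℕ) + 1) % a.1, Nat.mod_lt _ μ.pos⟩)

theorem circ_rotate (a : Σ k : ℕ, Fin k → Fin n) (μ : Fin a.1) :
    a.2 μ :: circ a μ = (List.ofFn a.2).rotate μ := by
  have := μ.pos
  apply List.ext_getElem
  · simp [circ]; omega
  · intro t h1 h2
    rw [List.getElem_rotate]
    rcases t with _ | t
    · simp [Nat.mod_eq_of_lt μ.2]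
    · simp only [circ, List.getElem_cons_succ, List.getElem_ofFn, List.length_ofFn]
      exact congrArg a.2 (Fin.ext (by
        change _ % _ = _ % _
        congr 1; omega))

theorem cV_circ (a : Σ k : ℕ, Fin k → Fin n) (μ : Fin a.1) (h : Odd a.1) :
    cV (a.2 μ) (circ a μ) = cW a := by
  rw [← cd_cT_cons, circ_rotate, cT_rotate _ (by simpa using h)]; rfl

theorem mem_circ (a : Σ k : ℕ, Fin k → Fin n) (μ : Fin a.1) (j : Fin n)
    (hj : j ∈ Finset.image a.2 Finset.univ) (hne : j ≠ a.2 μ) : j ∈ circ a μ := by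
  have : j ∈ a.2 μ :: circ a μ := by
    rw [circ_rotate]; simpa using hj
  simpa [hne] using this

theorem comm_cW (a : Σ k : ℕ, Fin k → Fin n) (h : Odd a.1) (x : GA ℤ (Fin n)) :
    Commute (cW a) x := by
  rw [← cV_circ a ⟨0, h.pos⟩ h]
  apply comm_cV
  obtain ⟨m, hm⟩ := h
  simp [circ, hm]

theorem cT_ofFn {k : ℕ} (v : Fin k → Fin n) :
    cT (List.ofFn v) = ExteriorAlgebra.ιMulti ℤ k (fun t => (Pi.single (v t) 1 : Fin n → ℤ)) := by
  rw [ExteriorAlgebra.ιMulti_apply, cT, List.map_ofFn]; rfl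

theorem cT_perm {k : ℕ} (v : Fin k → Fin n) (σ : Equiv.Perm (Fin k)) :
    cT (List.ofFn (v ∘ σ)) = (Equiv.Perm.sign σ : ℤ) • cT (List.ofFn v) := by
  rw [cT_ofFn, cT_ofFn]
  exact AlternatingMap.map_perm _ (fun t => (Pi.single (v t) 1 : Fin n → ℤ)) σ

theorem cT_listPerm (l : List (Fin n)) (h : l.length = n) (hl : l.Nodup) :
    cT l = (Equiv.Perm.sign (listPerm l) : ℤ) • cT (List.ofFn (id : Fin n → Fin n)) := by
  rw [← cT_perm]
  congr 1
  apply List.ext_getElem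
  · simp [h]
  · intro t h1 h2
    simp [listPerm, h, hl]

theorem cOmega (c d : ℤ) (h : c • cT (List.ofFn (id : Fin n → Fin n)) =
    d • cT (List.ofFn (id : Fin n → Fin n))) : c = d := by
  rw [cT_ofFn] at h
  have h2 := congrArg (ExteriorAlgebra.liftAlternating (R := ℤ)
    (Pi.single n Matrix.detRowAlternating :
      ∀ i : ℕ, (Fin n → ℤ) [⋀^Fin i]→ₗ[ℤ] ℤ)) h
  rw [map_smul, map_smul, ExteriorAlgebra.liftAlternating_apply_ιMulti] at h2
  rw [Pi.single_eq_same] at h2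
  have h3 : Matrix.detRowAlternating (R := ℤ) (fun t : Fin n => (Pi.single (id t) 1 : Fin n → ℤ)) = 1 := by
    change Matrix.det (Matrix.of (fun t : Fin n => (Pi.single (id t) 1 : Fin n → ℤ))) = 1
    rw [show (Matrix.of (fun t : Fin n => (Pi.single (id t) 1 : Fin n → ℤ))) = 1 from ?_]
    · simp
    · ext i j; simp [Matrix.one_apply, Pi.single_apply, eq_comm]
  rw [h3] at h2
  simpa using h2

theorem triang {X : Type*} (f : X → List (Fin n)) (r : X → Fin n) (δ : X → ℕ) :
    ∀ (M : List X) (l0 : List (Fin n)), M.Pairwise (fun x y => δ x ≤ δ y) →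
    (∀ x ∈ M, r x ∈ l0 ∨ ∃ y ∈ M, δ y < δ x ∧ r x ∈ f y) →
    cT l0 * (M.map (fun x => cV (r x) (f x))).prod = cT (l0 ++ (M.map f).flatten) := by
  intro M
  induction M with
  | nil => intro l0 _ _; simp
  | cons x M ih =>
    intro l0 hs hM
    rw [List.pairwise_cons] at hs
    have hx : r x ∈ l0 := by
      rcases hM x (by simp) with h | ⟨y, hy, hlt, -⟩
      · exact h
      · rcases List.mem_cons.1 hy with rfl | hy
        · omega
        · have := hs.1 y hy; omega
    rw [List.map_cons, List.prod_cons, ← mul_assoc, cT_mul_cV _ _ _ hx, ih _ hs.2]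
    · simp
    · intro z hz
      rcases hM z (by simp [hz]) with h | ⟨y, hy, hlt, hm⟩
      · left; simp [h]
      · rcases List.mem_cons.1 hy with rfl | hy
        · left; simp [hm]
        · right; exact ⟨y, hy, hlt, hm⟩

/-- Canonical sequence of a block. -/
def can (A : Finset (Fin n)) : Σ k : ℕ, Fin k → Fin n := ⟨A.card, A.orderEmbOfFin rfl⟩

theorem exists_sign (y : ∀ k : ℕ, (Fin k → Fin n) → R)
    (hy : ∀ (k : ℕ) (σ : Equiv.Perm (Fin k)) (α : Fin k → Fin n),
      y k (α ∘ σ) = ((Equiv.Perm.sign σ : ℤ) : R) * y k α)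
    (a : Σ k : ℕ, Fin k → Fin n) (ha : Function.Injective a.2) :
    ∃ s : ℤ, s * s = 1 ∧ cW a = s • cW (can (Finset.image a.2 Finset.univ)) ∧
      y a.1 a.2 = (s : R) * y (can (Finset.image a.2 Finset.univ)).1
        (can (Finset.image a.2 Finset.univ)).2 := by
  obtain ⟨k, v⟩ := a
  have hc : (Finset.image v Finset.univ).card = k := by
    rw [Finset.card_image_of_injective _ ha]; simp
  simp only [can]
  generalize hA : Finset.image v Finset.univ = A at *
  subst hc
  have hmem : ∀ t, v t ∈ A := fun t => by rw [← hA]; simp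
  let g : Fin A.card → Fin A.card := fun t => (A.orderIsoOfFin rfl).symm ⟨v t, hmem t⟩
  have hg : Function.Injective g := by
    intro s t h
    have := (A.orderIsoOfFin rfl).symm.injective h
    exact ha (by simpa using this)
  let σ : Equiv.Perm (Fin A.card) := Equiv.ofBijective g (Finite.injective_iff_bijective.mp hg)
  have hv : v = (A.orderEmbOfFin rfl) ∘ σ := by
    funext t
    simp only [Function.comp, σ, Equiv.ofBijective_apply, g, ← Finset.coe_orderIsoOfFin_apply]
    simp
  refine ⟨(Equiv.Perm.sign σ : ℤ), ?_, ?_, ?_⟩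
  · rw [← Units.val_mul, Int.units_mul_self]; rfl
  · simp only [cW]
    conv_lhs => rw [hv]
    rw [cT_perm, map_smul]
  · conv_lhs => rw [hv]
    exact hy _ _ _

theorem exists_sign_list (y : ∀ k : ℕ, (Fin k → Fin n) → R)
    (hy : ∀ (k : ℕ) (σ : Equiv.Perm (Fin k)) (α : Fin k → Fin n),
      y k (α ∘ σ) = ((Equiv.Perm.sign σ : ℤ) : R) * y k α)
    (l : List (Σ k : ℕ, Fin k → Fin n)) (hl : ∀ a ∈ l, Function.Injective a.2) :
    ∃ s : ℤ, s * s = 1 ∧ (l.map cW).prod =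
        s • ((l.map (fun a => Finset.image a.2 Finset.univ)).map (fun A => cW (can A))).prod ∧
      (l.map (fun a => y a.1 a.2)).prod = (s : R) *
        ((l.map (fun a => Finset.image a.2 Finset.univ)).map
          (fun A => y (can A).1 (can A).2)).prod := by
  induction l with
  | nil => exact ⟨1, by simp⟩
  | cons a l ih =>
    obtain ⟨s, hs, h1, h2⟩ := ih (fun b hb => hl b (by simp [hb]))
    obtain ⟨t, ht, h3, h4⟩ := exists_sign y hy a (hl a (by simp))
    refine ⟨t * s, by linear_combination t * t * hs + ht, ?_, ?_⟩
    · simp only [List.map_cons, List.prod_cons, h1, h3]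
      rw [smul_mul_smul_comm]
    · simp only [List.map_cons, List.prod_cons, h2, h4]
      push_cast; ring

theorem prod_perm {l₁ l₂ : List (GA ℤ (Fin n))} (h : l₁.Perm l₂)
    (hc : ∀ x ∈ l₁, ∀ z, Commute x z) : l₁.prod = l₂.prod := by
  induction h with
  | nil => rfl
  | cons x h ih =>
    simp only [List.prod_cons]
    rw [ih (fun y hy => hc y (by simp [hy]))]
  | swap x y l =>
    simp only [List.prod_cons, ← mul_assoc]
    rw [(hc x (by simp) y).eq]
  | trans h1 h2 ih1 ih2 =>
    rw [ih1 hc, ih2 (fun y hy => hc y (h1.mem_iff.2 hy))]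

theorem adj_iff (𝒜 : Finset (Finset (Fin n))) (A : {A // A ∈ 𝒜}) (j : Fin n) :
    (incGraph 𝒜).Adj (Sum.inl A) (Sum.inr j) ↔ j ∈ A.1 := by
  simp [incGraph]

theorem not_adj_rr (𝒜 : Finset (Finset (Fin n))) (i j : Fin n) :
    ¬ (incGraph 𝒜).Adj (Sum.inr i) (Sum.inr j) := by
  simp [incGraph]

theorem not_adj_ll (𝒜 : Finset (Finset (Fin n))) (A B : {A // A ∈ 𝒜}) :
    ¬ (incGraph 𝒜).Adj (Sum.inl A) (Sum.inl B) := by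
  simp [incGraph]

theorem edge_count (𝒜 : Finset (Finset (Fin n))) (h : (incGraph 𝒜).IsTree) :
    ∑ A ∈ 𝒜, A.card + 1 = 𝒜.card + n := by
  have h1 := h.card_edgeFinset
  have hb : (incGraph 𝒜).IsBipartiteWith
      ((Finset.univ.map Function.Embedding.inl : Finset ({A // A ∈ 𝒜} ⊕ Fin n)) : Set _)
      ((Finset.univ.map Function.Embedding.inr : Finset ({A // A ∈ 𝒜} ⊕ Fin n)) : Set _) := by
    constructor
    · rw [Set.disjoint_left]; rintro (x | x) <;> simp
    · rintro (x | x) (y | y) hxy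
      · exact absurd hxy (not_adj_ll _ _ _)
      · left; simp
      · right; simp
      · exact absurd hxy (not_adj_rr _ _ _)
  have h2 := SimpleGraph.isBipartiteWith_sum_degrees_eq_card_edges hb
  rw [← h2, Finset.sum_map] at h1
  have h3 : ∀ A : {A // A ∈ 𝒜}, (incGraph 𝒜).degree (Function.Embedding.inl A) = A.1.card := by
    intro A
    rw [← SimpleGraph.card_neighborFinset_eq_degree,
      ← Finset.card_map (Function.Embedding.inr : Fin n ↪ {A // A ∈ 𝒜} ⊕ Fin n)]
    congr 1
    ext (x | x)
    · simpa using not_adj_ll 𝒜 A x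
    · simpa using adj_iff 𝒜 A x
  rw [Finset.sum_congr rfl (fun A _ => h3 A), Finset.univ_eq_attach,
    Finset.sum_attach 𝒜 (fun A => A.card)] at h1
  simpa using h1

theorem exists_parent (𝒜 : Finset (Finset (Fin n))) (h : (incGraph 𝒜).IsTree) (i j : Fin n)
    (hij : j ≠ i) : ∃ A : {A // A ∈ 𝒜}, j ∈ A.1 ∧
      (incGraph 𝒜).dist (Sum.inl A) (Sum.inr i) < (incGraph 𝒜).dist (Sum.inr j) (Sum.inr i) := by
  obtain ⟨p, hp⟩ := (h.connected (Sum.inr j) (Sum.inr i)).exists_walk_length_eq_dist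
  rw [← hp]
  cases p with
  | nil => exact absurd rfl hij
  | @cons _ v _ hadj p =>
    rcases v with A | k
    · refine ⟨A, (adj_iff _ _ _).1 hadj.symm, ?_⟩
      have := SimpleGraph.dist_le p
      rw [SimpleGraph.Walk.length_cons]; omega
    · exact absurd hadj (not_adj_rr _ _ _)

theorem map_blocks (C : Finset (Σ k : ℕ, Fin k → Fin n)) (hC : RefinedCactus C)
    (l : List (Σ k : ℕ, Fin k → Fin n)) (hl : l.Nodup) (hlC : l.toFinset = C) :
    (l.map (fun a => Finset.image a.2 Finset.univ)).Nodup ∧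
    (l.map (fun a => Finset.image a.2 Finset.univ)).toFinset = cactusOf C := by
  constructor
  · apply List.Nodup.map_on _ hl
    intro x hx y hy hxy
    exact hC.2.1 (by simp [← hlC, hx]) (by simp [← hlC, hy]) hxy
  · rw [cactusOf, ← hlC]
    ext A; simp

theorem cactus_main (C : Finset (Σ k : ℕ, Fin k → Fin n)) (i : Fin n) (pl : List (Fin n))
    (hC : RefinedCactus C) (hpl : IsCactusList C i pl) :
    pl.length = n ∧ pl.Nodup ∧ ∃ l : List (Σ k : ℕ, Fin k → Fin n), l.Nodup ∧ l.toFinset = C ∧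
      ∀ i', cT pl = ce i' * (l.map cW).prod := by
  obtain ⟨L, hnd, hLC, hcirc, rfl⟩ := hpl
  have htree := hC.2.2.2
  have key : ∀ x : (Σ k : ℕ, Fin k → Fin n) × List (Fin n), ∃ (r : Fin n) (δ : ℕ), x ∈ L →
      ((∃ hA : Finset.image x.1.2 Finset.univ ∈ cactusOf C,
        δ = (incGraph (cactusOf C)).dist (Sum.inl ⟨_, hA⟩) (Sum.inr i)) ∧
      (incGraph (cactusOf C)).dist (Sum.inr r) (Sum.inr i) < δ ∧
      cV r x.2 = cW x.1 ∧ x.2.length + 1 = (Finset.image x.1.2 Finset.univ).card ∧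
      Even x.2.length ∧ Odd x.1.1 ∧
      ∀ j ∈ Finset.image x.1.2 Finset.univ, j ≠ r → j ∈ x.2) := by
    intro x
    by_cases hx : x ∈ L
    · obtain ⟨μ, hA, hd, hl⟩ := hcirc x hx
      have hxC : x.1 ∈ C := by
        rw [← hLC, List.mem_toFinset]; exact List.mem_map_of_mem hx
      obtain ⟨hodd, h3, hinj⟩ := hC.1 _ hxC
      have hl' : x.2 = circ x.1 μ := hl
      have hlen : x.2.length = x.1.1 - 1 := by rw [hl]; simp
      refine ⟨x.1.2 μ, _, fun _ => ⟨⟨hA, rfl⟩, hd, ?_, ?_, ?_, hodd, ?_⟩⟩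
      · rw [hl']; exact cV_circ _ _ hodd
      · rw [Finset.card_image_of_injective _ hinj, hlen]; simp; omega
      · obtain ⟨m, hm⟩ := hodd
        rw [hlen, hm]; simp
      · intro j hj hne
        rw [hl']; exact mem_circ _ _ _ hj hne
    · exact ⟨i, 0, fun h => absurd h hx⟩
  choose r δ key using key
  have parent : ∀ j, j ≠ i → ∃ x ∈ L,
      δ x < (incGraph (cactusOf C)).dist (Sum.inr j) (Sum.inr i) ∧ j ∈ x.2 := by
    intro j hj
    obtain ⟨⟨A, hA⟩, hjA, hlt⟩ := exists_parent _ htree i j hj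
    have hA' := hA
    simp only [cactusOf, Finset.mem_image] at hA'
    obtain ⟨a, ha, haA⟩ := hA'
    rw [← hLC, List.mem_toFinset, List.mem_map] at ha
    obtain ⟨x, hx, rfl⟩ := ha
    obtain ⟨⟨hA2, hδ⟩, hr, -, -, -, -, hmem⟩ := key x hx
    subst haA
    refine ⟨x, hx, by rw [hδ]; exact hlt, hmem j hjA ?_⟩
    rintro rfl
    rw [hδ] at hr
    exact absurd (hr.trans hlt) (lt_irrefl _)
  have hcov : ∀ j, j ∈ i :: (L.map Prod.snd).flatten := by
    intro j
    by_cases hj : j = i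
    · simp [hj]
    · obtain ⟨x, hx, -, hjx⟩ := parent j hj
      rw [List.mem_cons, List.mem_flatten]
      exact Or.inr ⟨x.2, List.mem_map_of_mem hx, hjx⟩
  obtain ⟨hb1, hb2⟩ := map_blocks C hC _ hnd hLC
  have hlen : (i :: (L.map Prod.snd).flatten).length = n := by
    have he := edge_count _ htree
    rw [← hb2, List.sum_toFinset _ hb1, List.toFinset_card_of_nodup hb1] at he
    simp only [List.map_map, List.length_map] at he
    have e1 : L.map ((Finset.card ∘ fun a : (Σ k : ℕ, Fin k → Fin n) =>
        Finset.image a.2 Finset.univ) ∘ Prod.fst) = L.map (fun x => x.2.length + 1) := by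
      apply List.map_congr_left
      intro x hx
      exact (key x hx).2.2.2.1.symm
    have e2 : ∀ M : List ((Σ k : ℕ, Fin k → Fin n) × List (Fin n)),
        (M.map (fun x => x.2.length + 1)).sum = (M.map Prod.snd).flatten.length + M.length := by
      intro M
      induction M with
      | nil => simp
      | cons x M ih =>
        simp only [List.map_cons, List.sum_cons, List.flatten_cons, List.length_append,
          List.length_cons, ih]
        omega
    have e3 := e2 L
    rw [← e1] at e3
    simp only [List.length_cons]
    have he' : (L.map ((Finset.card ∘ fun a : (Σ k : ℕ, Fin k → Fin n) =>
        Finset.image a.2 Finset.univ) ∘ Prod.fst)).sum + 1 = L.length + n := he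
    omega
  have hnodup : (i :: (L.map Prod.snd).flatten).Nodup := by
    rw [← Multiset.coe_nodup, ← Multiset.toFinset_card_eq_card_iff_nodup]
    have : Multiset.toFinset (↑(i :: (L.map Prod.snd).flatten) : Multiset (Fin n))
        = Finset.univ := by
      ext j; simpa using hcov j
    rw [this, Multiset.coe_card, hlen]; simp
  refine ⟨hlen, hnodup, L.map Prod.fst, hnd, hLC, ?_⟩
  let M := L.mergeSort (fun x y => decide (δ x ≤ δ y))
  have hML : M.Perm L := List.mergeSort_perm _ _
  have hMs : M.Pairwise (fun x y => δ x ≤ δ y) := by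
    have := List.pairwise_mergeSort (le := fun x y => decide (δ x ≤ δ y))
      (fun a b c h1 h2 => by simp at *; omega) (fun a b => by simp; omega) L
    simpa using this
  have hM : ce i * (M.map (fun x => cV (r x) x.2)).prod = cT ([i] ++ (M.map Prod.snd).flatten) := by
    rw [← triang Prod.snd r δ M [i] hMs]
    · simp [cT]
    · intro x hx
      by_cases hr : r x = i
      · left; simp [hr]
      · right
        obtain ⟨y, hy, hlt, hm⟩ := parent _ hr
        exact ⟨y, hML.mem_iff.2 hy, hlt.trans (key x (hML.mem_iff.1 hx)).2.1, hm⟩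
  have hflat : ∀ N : List ((Σ k : ℕ, Fin k → Fin n) × List (Fin n)),
      cT ((N.map Prod.snd).flatten) = (N.map (fun x => cT x.2)).prod := by
    intro N
    induction N with
    | nil => simp [cT]
    | cons x N ih => simp [cT_append, ih]
  have hi : cT (i :: (L.map Prod.snd).flatten) = ce i * ((L.map Prod.fst).map cW).prod := by
    have e1 : cT (i :: (L.map Prod.snd).flatten) = cT ([i] ++ (M.map Prod.snd).flatten) := by
      rw [show i :: (L.map Prod.snd).flatten = [i] ++ (L.map Prod.snd).flatten from rfl,
        cT_append, cT_append, hflat, hflat]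
      congr 1
      apply prod_perm (hML.symm.map _)
      intro x hx z
      obtain ⟨y, hy, rfl⟩ := List.mem_map.1 hx
      exact comm_cT _ (key y hy).2.2.2.2.1 z
    rw [e1, ← hM]
    congr 1
    have e2 : M.map (fun x => cV (r x) x.2) = M.map (fun x => cW x.1) := by
      apply List.map_congr_left
      intro x hx
      exact (key x (hML.mem_iff.1 hx)).2.2.1
    rw [e2, List.map_map]
    apply prod_perm (hML.map _)
    intro x hx z
    obtain ⟨y, hy, rfl⟩ := List.mem_map.1 hx
    exact comm_cW _ (key y (hML.mem_iff.1 hy)).2.2.2.2.2.1 z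
  have hd0 : cd ((L.map Prod.fst).map cW).prod = 0 := by
    have : ∀ N : List ((Σ k : ℕ, Fin k → Fin n) × List (Fin n)), (∀ x ∈ N, x ∈ L) →
        cd ((N.map Prod.fst).map cW).prod = 0 := by
      intro N
      induction N with
      | nil => intro _; simpa using cd_one
      | cons x N ih =>
        intro h
        simp only [List.map_cons, List.prod_cons]
        rw [← (key x (h x (by simp))).2.2.1]
        exact cd_cV_mul _ _ _ (ih (fun y hy => h y (by simp [hy])))
    exact this L (fun _ h => h)
  intro i'
  have h0 := congrArg cd (ce_mul_cT i' _ (hcov i'))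
  rw [cd_ce_mul, map_zero, sub_eq_zero] at h0
  rw [h0, hi, cd_ce_mul, hd0]; simp

end CactusAux

/-- The amplitude `Y_{i,C} = ε_{i,C} Π_{α∈C} y_α` of a refined cactus is independent of the
choice of the global root `i` and of the refined cactus `C` refining a given cactus `𝒜`. -/
theorem cactus_amplitude_well_defined (n : ℕ) (hn : Odd n)
    (y : ∀ k : ℕ, (Fin k → Fin n) → R)
    (hy : ∀ (k : ℕ) (σ : Equiv.Perm (Fin k)) (α : Fin k → Fin n),
      y k (α ∘ σ) = ((Equiv.Perm.sign σ : ℤ) : R) * y k α)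
    (𝒜 : Finset (Finset (Fin n))) (h𝒜 : IsCactus 𝒜)
    (C C' : Finset (Σ k : ℕ, Fin k → Fin n)) (i i' : Fin n) (pl pl' : List (Fin n))
    (hC : RefinedCactus C) (hC' : RefinedCactus C')
    (hCA : cactusOf C = 𝒜) (hCA' : cactusOf C' = 𝒜)
    (hpl : IsCactusList C i pl) (hpl' : IsCactusList C' i' pl') :
    ((Equiv.Perm.sign (listPerm pl) : ℤ) : R) * ∏ a ∈ C, y a.1 a.2 =
      ((Equiv.Perm.sign (listPerm pl') : ℤ) : R) * ∏ a ∈ C', y a.1 a.2 := by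
  obtain ⟨hlen, hnd, l, hl, hlC, hT⟩ := CactusAux.cactus_main C i pl hC hpl
  obtain ⟨hlen', hnd', l', hl', hlC', hT'⟩ := CactusAux.cactus_main C' i' pl' hC' hpl'
  obtain ⟨hb1, hb2⟩ := CactusAux.map_blocks C hC l hl hlC
  obtain ⟨hb1', hb2'⟩ := CactusAux.map_blocks C' hC' l' hl' hlC'
  have hinj : ∀ a ∈ l, Function.Injective a.2 := fun a ha =>
    (hC.1 a (by rw [← hlC]; simpa using ha)).2.2
  have hinj' : ∀ a ∈ l', Function.Injective a.2 := fun a ha =>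
    (hC'.1 a (by rw [← hlC']; simpa using ha)).2.2
  obtain ⟨s, hs, h1, h2⟩ := CactusAux.exists_sign_list y hy l hinj
  obtain ⟨s', hs', h1', h2'⟩ := CactusAux.exists_sign_list y hy l' hinj'
  have hperm : (l.map (fun a => Finset.image a.2 Finset.univ)).Perm
      (l'.map (fun a => Finset.image a.2 Finset.univ)) := by
    apply List.perm_of_nodup_nodup_toFinset_eq hb1 hb1'
    rw [hb2, hb2', hCA, hCA']
  have hQ := CactusAux.prod_perm (hperm.map (fun A => CactusAux.cW (CactusAux.can A))) (by
    intro x hx z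
    obtain ⟨A, hA, rfl⟩ := List.mem_map.1 hx
    apply CactusAux.comm_cW
    have : A ∈ 𝒜 := by rw [← hCA, ← hb2]; simpa using hA
    exact (h𝒜.1 A this).1)
  have hY := (hperm.map (fun A => y (CactusAux.can A).1 (CactusAux.can A).2)).prod_eq
  have e1 := hT i
  have e2 := hT' i
  rw [CactusAux.cT_listPerm _ hlen hnd, h1, mul_smul_comm] at e1
  rw [CactusAux.cT_listPerm _ hlen' hnd', h1', mul_smul_comm, ← hQ] at e2
  have e5 : ((s * (Equiv.Perm.sign (listPerm pl) : ℤ)) : ℤ) =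
      s' * (Equiv.Perm.sign (listPerm pl') : ℤ) := by
    apply CactusAux.cOmega (n := n)
    rw [mul_smul, mul_smul, e1, e2, smul_smul, smul_smul, hs, hs']
  have p1 : ∏ a ∈ C, y a.1 a.2 = (l.map (fun a => y a.1 a.2)).prod := by
    rw [← hlC, List.prod_toFinset _ hl]
  have p2 : ∏ a ∈ C', y a.1 a.2 = (l'.map (fun a => y a.1 a.2)).prod := by
    rw [← hlC', List.prod_toFinset _ hl']
  rw [p1, p2, h2, h2', hY]
  have e6 := congrArg (fun z : ℤ => (z : R)) e5
  simp only [Int.cast_mul] at e6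
  rw [← mul_assoc, ← mul_assoc, mul_comm _ (s : R), mul_comm _ (s' : R), e6]
end
end

section
/- Hyperpfaffian-cactus theorem: for n odd and completely antisymmetric tensors y^{[k]} for each odd k with 3 ≤ k ≤ n, the Berezin integral ∫ dχₙ⋯dχ₁ χᵢ exp( Σ_{k odd, 3≤k≤n} (1/(k−1)!) Σ_{(α₁,…,α_k)∈[n]^k} y^{[k]}_{α₁…α_k} χ_{α₂}χ_{α₃}⋯χ_{α_k} ) is independent of i ∈ {1,…,n} and equals Σ_𝒜 Y_𝒜, the sum over all odd cacti 𝒜 of their amplitudes. -/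
set_option synthInstance.maxHeartbeats 1000000
set_option maxHeartbeats 1000000

noncomputable section

variable {R : Type*} [CommRing R] [Algebra ℚ R]

open scoped Classical

/-- The amplitude `Y_𝒜` of a cactus `𝒜`: `ε_{i,C} Π_{α∈C} y_α` for any (hence, by the
well-definedness lemma, every) choice of global root `i` and refined cactus `C`
with underlying cactus `𝒜` (and `0` if no such choice exists). -/
noncomputable def cactusAmp {R : Type*} [CommRing R] {n : ℕ}
    (y : ∀ k : ℕ, (Fin k → Fin n) → R) (𝒜 : Finset (Finset (Fin n))) : R :=
  if h : ∃ x : Finset (Σ k : ℕ, Fin k → Fin n) × Fin n × List (Fin n),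
      RefinedCactus x.1 ∧ cactusOf x.1 = 𝒜 ∧ IsCactusList x.1 x.2.1 x.2.2 then
    ((Equiv.Perm.sign (listPerm h.choose.2.2) : ℤ) : R) * ∏ a ∈ h.choose.1, y a.1 a.2
  else 0


section helpers

set_option linter.unusedSectionVars false

/-- monomial of a list of generators -/
def mon (R : Type*) [CommRing R] {n : ℕ} (l : List (Fin n)) : GA R (Fin n) :=
  (l.map (fun i => (gaGen i : GA R (Fin n)))).prod

/-- contraction -/
def DD {R : Type*} [CommRing R] {n : ℕ} (d : Module.Dual R (Fin n → R)) :
    GA R (Fin n) →ₗ[R] GA R (Fin n) :=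
  CliffordAlgebra.contractLeft (Q := (0 : QuadraticForm R (Fin n → R))) d

variable {n : ℕ}

lemma mon_nil : mon R ([] : List (Fin n)) = 1 := rfl

lemma mon_cons (i : Fin n) (l : List (Fin n)) : mon R (i :: l) = gaGen i * mon R l := by
  simp [mon]

lemma mon_append (l l' : List (Fin n)) : mon R (l ++ l') = mon R l * mon R l' := by
  simp [mon]

lemma DD_gen_mul (d : Module.Dual R (Fin n → R)) (i : Fin n) (x : GA R (Fin n)) :
    DD d (gaGen i * x) = d (Pi.single i 1) • x - gaGen i * DD d x :=
  CliffordAlgebra.contractLeft_ι_mul (Q := (0 : QuadraticForm R (Fin n → R))) d _ x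

lemma DD_one (d : Module.Dual R (Fin n → R)) : DD d (1 : GA R (Fin n)) = 0 :=
  CliffordAlgebra.contractLeft_one (Q := (0 : QuadraticForm R (Fin n → R))) d

lemma DD_DD (d : Module.Dual R (Fin n → R)) (x : GA R (Fin n)) : DD d (DD d x) = 0 :=
  CliffordAlgebra.contractLeft_contractLeft (Q := (0 : QuadraticForm R (Fin n → R))) d x

lemma DD_comm (d d' : Module.Dual R (Fin n → R)) (x : GA R (Fin n)) :
    DD d (DD d' x) = - DD d' (DD d x) :=
  CliffordAlgebra.contractLeft_comm (Q := (0 : QuadraticForm R (Fin n → R))) d d' x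

lemma gaDeriv_eq (i : Fin n) : (gaDeriv i : GA R (Fin n) →ₗ[R] _) = DD (LinearMap.proj i) := rfl

lemma gen_sq (i : Fin n) : (gaGen i : GA R (Fin n)) * gaGen i = 0 :=
  ExteriorAlgebra.ι_sq_zero _

lemma gen_swap (i j : Fin n) : (gaGen i : GA R (Fin n)) * gaGen j = - (gaGen j * gaGen i) :=
  eq_neg_of_add_eq_zero_left (ExteriorAlgebra.ι_add_mul_swap _ _)

lemma mon_mul_gen (l : List (Fin n)) (i : Fin n) :
    mon R l * gaGen i = (-1 : R) ^ l.length • (gaGen i * mon R l) := by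
  induction l with
  | nil => simp [mon_nil]
  | cons j l ih =>
    rw [mon_cons, mul_assoc, ih, mul_smul_comm, ← mul_assoc, gen_swap, List.length_cons, pow_succ,
      mul_smul]
    simp [mul_assoc]

lemma gen_mul_mon_eq_zero (l : List (Fin n)) (i : Fin n) (h : i ∈ l) :
    gaGen i * mon R l = 0 := by
  induction l with
  | nil => simp at h
  | cons j l ih =>
    rw [mon_cons, ← mul_assoc]
    by_cases hij : i = j
    · subst hij; rw [gen_sq, zero_mul]
    · have : i ∈ l := by simpa [hij] using h
      rw [gen_swap, neg_mul, mul_assoc, ih this]; simp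

lemma mon_eq_zero (l : List (Fin n)) (h : ¬ l.Nodup) : mon R l = 0 := by
  induction l with
  | nil => simp at h
  | cons j l ih =>
    rw [mon_cons]
    by_cases hj : j ∈ l
    · exact gen_mul_mon_eq_zero l j hj
    · rw [ih (by simpa [hj] using h), mul_zero]

lemma DD_mon_mul (d : Module.Dual R (Fin n → R)) (l : List (Fin n)) (x : GA R (Fin n)) :
    DD d (mon R l * x) = DD d (mon R l) * x + (-1 : R) ^ l.length • (mon R l * DD d x) := by
  induction l with
  | nil => simp [mon_nil, DD_one]
  | cons j l ih =>
    rw [mon_cons, mul_assoc, DD_gen_mul, ih, DD_gen_mul, List.length_cons, pow_succ]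
    simp only [sub_mul, mul_add, smul_mul_assoc, mul_smul_comm, mul_assoc]
    simp
    abel

lemma deriv_mon_eq_zero (l : List (Fin n)) (i : Fin n) (h : i ∉ l) :
    DD (LinearMap.proj i) (mon R l) = 0 := by
  induction l with
  | nil => simp [mon_nil, DD_one]
  | cons j l ih =>
    simp only [List.mem_cons, not_or] at h
    rw [mon_cons, DD_gen_mul, ih h.2]
    simp [Pi.single_apply, h.1]

lemma bint_append (l l' : List (Fin n)) (x : GA R (Fin n)) :
    bint (l ++ l') x = bint l (bint l' x) := by
  induction l with
  | nil => rfl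
  | cons j l ih => simp [bint, ih]

/-- bint as a linear map -/
def bintL (R : Type*) [CommRing R] {n : ℕ} : List (Fin n) → (GA R (Fin n) →ₗ[R] GA R (Fin n))
  | [] => LinearMap.id
  | i :: t => (gaDeriv i).comp (bintL R t)

lemma bint_eq (l : List (Fin n)) (x : GA R (Fin n)) : bint l x = bintL R l x := by
  induction l with
  | nil => rfl
  | cons j l ih => simp [bint, bintL, ih]

lemma bint_deriv (l : List (Fin n)) (i : Fin n) (x : GA R (Fin n)) :
    bint l (DD (LinearMap.proj i) x) = (-1 : R) ^ l.length • DD (LinearMap.proj i) (bint l x) := by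
  induction l with
  | nil => simp [bint]
  | cons j l ih =>
    rw [bint, ih, gaDeriv_eq, map_smul, DD_comm, List.length_cons, pow_succ, mul_smul, bint,
      gaDeriv_eq]
    simp

lemma bint_deriv_eq_zero (l : List (Fin n)) (i : Fin n) (hi : i ∈ l) (x : GA R (Fin n)) :
    bint l (DD (LinearMap.proj i) x) = 0 := by
  induction l with
  | nil => simp at hi
  | cons j l ih =>
    rw [bint]
    by_cases hij : i = j
    · subst hij
      rw [bint_deriv, gaDeriv_eq, map_smul, DD_DD, smul_zero]
    · rw [ih (by simpa [hij] using hi), map_zero]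

lemma bint_mon_eq_zero (l l' : List (Fin n)) (i : Fin n) (hi : i ∈ l) (hi' : i ∉ l') :
    bint l (mon R l') = 0 := by
  induction l with
  | nil => simp at hi
  | cons j l ih =>
    rw [bint]
    by_cases hil : i ∈ l
    · rw [ih hil, map_zero]
    · have hij : i = j := by simpa [hil] using hi
      subst hij
      have h := bint_deriv (R := R) l i (mon R l')
      rw [deriv_mon_eq_zero _ _ hi', bint_eq, map_zero] at h
      rw [gaDeriv_eq]
      have h2 : ((-1 : R) ^ l.length * (-1 : R) ^ l.length) •
        DD (LinearMap.proj i) (bint l (mon R l')) = 0 := by rw [mul_smul, ← h, smul_zero]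
      rwa [← mul_pow, neg_one_mul, neg_neg, one_pow, one_smul] at h2

lemma bint_reverse_mon (l : List (Fin n)) (h : l.Nodup) :
    bint l.reverse (mon R l) = 1 := by
  induction l with
  | nil => rfl
  | cons j l ih =>
    rw [List.nodup_cons] at h
    rw [List.reverse_cons, bint_append]
    simp only [bint]
    rw [gaDeriv_eq, mon_cons, DD_gen_mul, deriv_mon_eq_zero _ _ h.1]
    simpa using ih h.2

/-- the Berezin integral -/
def top (R : Type*) [CommRing R] {n : ℕ} : GA R (Fin n) →ₗ[R] R :=
  (gaCoef : GA R (Fin n) →ₐ[R] R).toLinearMap.comp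
    (bintL R (List.ofFn (id : Fin n → Fin n)).reverse)

lemma top_eq (x : GA R (Fin n)) :
    gaCoef (bint ((List.ofFn (id : Fin n → Fin n)).reverse) x) = top R x := by
  rw [bint_eq]; rfl

lemma top_DD (d : Module.Dual R (Fin n → R)) (x : GA R (Fin n)) : top R (DD d x) = 0 := by
  have hd : d = ∑ i, d (Pi.single i 1) • (LinearMap.proj i : Module.Dual R (Fin n → R)) := by
    apply LinearMap.pi_ext'
    intro i
    ext
    simp [Pi.single_apply]
  have : DD d x = ∑ i, d (Pi.single i 1) • DD (LinearMap.proj i) x := by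
    conv_lhs => rw [hd]
    simp [DD]
  rw [this, map_sum]
  apply Finset.sum_eq_zero
  intro i _
  rw [map_smul, ← top_eq, bint_deriv_eq_zero _ _ (by simp [List.mem_ofFn])]
  simp

lemma top_mon_eq_zero (l : List (Fin n)) (h : l.length ≠ n) : top R (mon R l) = 0 := by
  by_cases hn : l.Nodup
  · have : ∃ i, i ∉ l := by
      by_contra! hc
      apply h
      have : l.toFinset = Finset.univ := by ext; simp [hc]
      rw [← List.toFinset_card_of_nodup hn, this]; simp
    obtain ⟨i, hi⟩ := this
    rw [← top_eq, bint_mon_eq_zero _ _ i (by simp [List.mem_ofFn]) hi, map_zero]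
  · rw [mon_eq_zero _ hn, map_zero]

lemma mon_ofFn {k : ℕ} (α : Fin k → Fin n) :
    mon R (List.ofFn α) = ExteriorAlgebra.ιMulti R k (fun t => Pi.single (α t) (1 : R)) := by
  rw [ExteriorAlgebra.ιMulti_apply, mon, List.map_ofFn]; rfl

lemma mon_perm {k : ℕ} (α : Fin k → Fin n) (σ : Equiv.Perm (Fin k)) :
    mon R (List.ofFn (α ∘ σ)) = ((Equiv.Perm.sign σ : ℤ) : R) • mon R (List.ofFn α) := by
  rw [mon_ofFn, mon_ofFn]
  have := (ExteriorAlgebra.ιMulti R k).map_perm (fun t => (Pi.single (α t) (1 : R) : Fin n → R)) σ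
  rw [Int.cast_smul_eq_zsmul]
  exact this

lemma top_mon (l : List (Fin n)) (h : l.length = n) (hn : l.Nodup) :
    top R (mon R l) = ((Equiv.Perm.sign (listPerm l) : ℤ) : R) := by
  have hl : l = List.ofFn (id ∘ (listPerm l)) := by
    apply List.ext_get
    · simp [h]
    · intro t h1 h2
      simp [listPerm, h, hn]
  conv_lhs => rw [hl]
  rw [mon_perm, map_smul, ← top_eq, bint_reverse_mon _ (List.nodup_ofFn.2 Function.injective_id)]
  simp

end helpers

section helpers2

set_option linter.unusedSectionVars false

variable {n : ℕ}

/-- homogeneous elements -/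
def HH (R : Type*) [CommRing R] (n m : ℕ) : Submodule R (GA R (Fin n)) :=
  Submodule.span R {x | ∃ l : List (Fin n), l.length = m ∧ x = mon R l}

lemma mon_mem_HH (l : List (Fin n)) : mon R l ∈ HH R n l.length :=
  Submodule.subset_span ⟨l, rfl, rfl⟩

lemma HH_mul {a b : ℕ} {x z : GA R (Fin n)} (hx : x ∈ HH R n a) (hz : z ∈ HH R n b) :
    x * z ∈ HH R n (a + b) := by
  have h := Submodule.mul_mem_mul hx hz
  rw [HH, HH, Submodule.span_mul_span] at h
  refine Submodule.span_mono ?_ h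
  rintro _ ⟨_, ⟨l, hl, rfl⟩, _, ⟨l', hl', rfl⟩, rfl⟩
  exact ⟨l ++ l', by simp [hl, hl'], (mon_append l l').symm⟩

lemma HH_top {m : ℕ} (hm : m ≠ n) {x : GA R (Fin n)} (hx : x ∈ HH R n m) : top R x = 0 := by
  induction hx using Submodule.span_induction with
  | mem x h => obtain ⟨l, hl, rfl⟩ := h; exact top_mon_eq_zero l (by omega)
  | zero => simp
  | add x y _ _ hx hy => simp [hx, hy]
  | smul a x _ hx => simp [hx]

lemma HH_comm {m : ℕ} (hm : Even m) {x : GA R (Fin n)} (hx : x ∈ HH R n m) (z : GA R (Fin n)) :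
    x * z = z * x := by
  induction hx using Submodule.span_induction with
  | mem x h =>
    obtain ⟨l, hl, rfl⟩ := h
    induction z using ExteriorAlgebra.induction with
    | algebraMap r => exact (Algebra.commutes r _).symm
    | ι v =>
      have : ExteriorAlgebra.ι R v = ∑ i, v i • (gaGen i : GA R (Fin n)) := by
        conv_lhs => rw [← LinearMap.sum_single_apply (fun _ : Fin n => R) v]
        rw [map_sum]
        refine Finset.sum_congr rfl fun i _ => ?_
        rw [gaGen, ← map_smul, ← Pi.single_smul]
        simp
      rw [this, Finset.mul_sum, Finset.sum_mul]
      refine Finset.sum_congr rfl fun i _ => ?_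
      rw [mul_smul_comm, smul_mul_assoc, mon_mul_gen, hl, hm.neg_one_pow, one_smul]
    | mul a b ha hb => rw [← mul_assoc, ha, mul_assoc, hb, mul_assoc]
    | add a b ha hb => rw [mul_add, add_mul, ha, hb]
  | zero => simp
  | add x y _ _ hx hy => rw [mul_add, add_mul, hx, hy]
  | smul a x _ hx => simp [hx]

lemma HH_leibniz {m : ℕ} (hm : Even m) {x : GA R (Fin n)} (hx : x ∈ HH R n m)
    (d : Module.Dual R (Fin n → R)) (z : GA R (Fin n)) :
    DD d (x * z) = DD d x * z + x * DD d z := by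
  induction hx using Submodule.span_induction with
  | mem x h =>
    obtain ⟨l, hl, rfl⟩ := h
    rw [DD_mon_mul, hl, hm.neg_one_pow, one_smul]
  | zero => simp
  | add x y _ _ hx hy => rw [add_mul, map_add, hx, hy, map_add, add_mul, add_mul]; abel
  | smul a x _ hx => simp [hx]

lemma DD_mon_mem (d : Module.Dual R (Fin n → R)) (l : List (Fin n)) (m : ℕ)
    (hl : l.length = m + 1) : DD d (mon R l) ∈ HH R n m := by
  induction l generalizing m with
  | nil => simp at hl
  | cons j l ih =>
    rw [mon_cons, DD_gen_mul]
    have hm : l.length = m := by simpa using hl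
    refine Submodule.sub_mem _ (Submodule.smul_mem _ _ (hm ▸ mon_mem_HH l)) ?_
    cases m with
    | zero =>
      have : l = [] := List.length_eq_zero_iff.1 hm
      subst this
      simp [mon_nil, DD_one]
    | succ m =>
      have h1 : (gaGen j : GA R (Fin n)) ∈ HH R n 1 := by
        have := mon_mem_HH (R := R) [j]
        rwa [mon_cons, mon_nil, mul_one] at this
      have := HH_mul h1 (ih m hm)
      rwa [add_comm] at this

/-- indicator functional -/
def dU (R : Type*) [CommRing R] {n : ℕ} (U : Finset (Fin n)) : Module.Dual R (Fin n → R) :=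
  ∑ u ∈ U, LinearMap.proj u

lemma dU_single (U : Finset (Fin n)) (i : Fin n) :
    dU R U (Pi.single i 1) = if i ∈ U then 1 else 0 := by
  simp [dU, Pi.single_apply]

/-- the block element -/
def ww (R : Type*) [CommRing R] {n k : ℕ} (α : Fin k → Fin n) : GA R (Fin n) :=
  DD (dU R Finset.univ) (mon R (List.ofFn α))

lemma ww_mem {k : ℕ} (hk : Odd k) (α : Fin k → Fin n) : ww R α ∈ HH R n (k - 1) := by
  apply DD_mon_mem
  obtain ⟨m, rfl⟩ := hk
  simp

lemma DD_const (d : Module.Dual R (Fin n → R)) (c : R) (l : List (Fin n))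
    (h : ∀ i ∈ l, d (Pi.single i 1) = c) :
    DD d (mon R l) = c • DD (dU R Finset.univ) (mon R l) := by
  induction l with
  | nil => simp [mon_nil, DD_one]
  | cons j l ih =>
    rw [mon_cons, DD_gen_mul, DD_gen_mul, ih (fun i hi => h i (by simp [hi])), h j (by simp),
      dU_single]
    simp [smul_sub]

lemma DD_ww {k : ℕ} (α : Fin k → Fin n) (U : Finset (Fin n))
    (h : (∀ t, α t ∈ U) ∨ (∀ t, α t ∉ U)) : DD (dU R U) (ww R α) = 0 := by
  have : ∃ c : R, ∀ i ∈ List.ofFn α, dU R U (Pi.single i 1) = c := by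
    rcases h with h | h
    · refine ⟨1, fun i hi => ?_⟩
      obtain ⟨t, rfl⟩ := (List.mem_ofFn' _ _).1 hi
      rw [dU_single, if_pos (h t)]
    · refine ⟨0, fun i hi => ?_⟩
      obtain ⟨t, rfl⟩ := (List.mem_ofFn' _ _).1 hi
      rw [dU_single, if_neg (h t)]
  obtain ⟨c, hc⟩ := this
  rw [ww, DD_comm, DD_const _ c _ hc, map_smul, DD_DD, smul_zero, neg_zero]

lemma mon_rotate (l : List (Fin n)) (hl : Odd l.length) (j : ℕ) :
    mon R (l.rotate j) = mon R l := by
  induction j generalizing l with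
  | zero => simp
  | succ j ih =>
    cases l with
    | nil => simp
    | cons a l =>
      rw [List.rotate_cons_succ, ih _ (by simpa using hl), mon_append, mon_cons, mon_cons, mon_nil,
        mul_one, mon_mul_gen]
      have : Even l.length := by
        rw [List.length_cons] at hl
        rcases Nat.even_or_odd l.length with h | h
        · exact h
        · exact absurd hl (by simpa using h.add_one)
      rw [this.neg_one_pow, one_smul]

/-- the circulation list -/
def circ {n k : ℕ} (α : Fin k → Fin n) (μ : Fin k) : List (Fin n) :=
  List.ofFn (fun t : Fin (k - 1) => α ⟨((μ : ℕ) + (t : ℕ) + 1) % k, Nat.mod_lt _ μ.pos⟩)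

lemma circ_rotate {k : ℕ} (α : Fin k → Fin n) (μ : Fin k) :
    (List.ofFn α).rotate μ = α μ :: circ α μ := by
  have hμ := μ.2
  apply List.ext_getElem
  · simp [circ]; omega
  · intro t h1 h2
    rw [List.getElem_rotate]
    cases t with
    | zero => simp [Nat.mod_eq_of_lt hμ]
    | succ t =>
      simp only [circ, List.getElem_ofFn, List.getElem_cons_succ, List.length_ofFn]
      congr 2
      congr 1
      omega

lemma gen_mul_ww {k : ℕ} (hk : Odd k) (α : Fin k → Fin n) (μ : Fin k) :
    gaGen (α μ) * ww R α = gaGen (α μ) * mon R (circ α μ) := by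
  rw [ww, ← mon_rotate _ (by simpa using hk) μ, circ_rotate, mon_cons, DD_gen_mul, dU_single]
  simp [mul_sub, ← mul_assoc, gen_sq]

lemma mon_mul_ww {k : ℕ} (hk : Odd k) (α : Fin k → Fin n) (μ : Fin k) (l : List (Fin n))
    (h : α μ ∈ l) : mon R l * ww R α = mon R l * mon R (circ α μ) := by
  obtain ⟨l1, l2, rfl⟩ := List.append_of_mem h
  have hk1 : Even (k - 1) := by obtain ⟨m, rfl⟩ := hk; simp
  have hc : mon R (circ α μ) ∈ HH R n (k - 1) := by
    have := mon_mem_HH (R := R) (circ α μ)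
    simpa [circ] using this
  rw [mon_append, mon_cons, mul_assoc, mul_assoc, mul_assoc, mul_assoc,
    ← HH_comm hk1 (ww_mem hk α), ← HH_comm hk1 hc, ← mul_assoc (gaGen _), gen_mul_ww hk,
    mul_assoc]

lemma ww_sq {k : ℕ} (hk : Odd k) (hk3 : 3 ≤ k) (α : Fin k → Fin n) : ww R α * ww R α = 0 := by
  have hk1 : Even (k - 1) := by obtain ⟨m, rfl⟩ := hk; simp
  let μ : Fin k := ⟨0, by omega⟩
  have hc : mon R (circ α μ) ∈ HH R n (k - 1) := by
    have := mon_mem_HH (R := R) (circ α μ)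
    simpa [circ] using this
  have h0 : gaGen (α μ) * (ww R α * ww R α) = 0 := by
    rw [← mul_assoc, gen_mul_ww hk, mul_assoc, HH_comm hk1 hc, ← mul_assoc, gen_mul_ww hk,
      mul_assoc, ← mon_append, mon_eq_zero, mul_zero]
    have : circ α μ ≠ [] := by
      rw [← List.length_pos_iff]
      simp [circ]; omega
    obtain ⟨a, t, ht⟩ := List.exists_cons_of_ne_nil this
    rw [ht]
    simp
  have h1 : DD (dU R Finset.univ) (ww R α) = 0 := DD_DD _ _
  have := congrArg (DD (dU R Finset.univ)) h0
  rw [DD_gen_mul, HH_leibniz hk1 (ww_mem hk α), h1, dU_single] at this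
  simpa using this

lemma ww_perm {k : ℕ} (α : Fin k → Fin n) (σ : Equiv.Perm (Fin k)) :
    ww R (α ∘ σ) = ((Equiv.Perm.sign σ : ℤ) : R) • ww R α := by
  rw [ww, mon_perm, map_smul, ww]

lemma ww_not_inj {k : ℕ} (α : Fin k → Fin n) (h : ¬ Function.Injective α) : ww R α = 0 := by
  rw [ww, mon_eq_zero, map_zero]
  rwa [List.nodup_ofFn]

lemma ww_sum {m : ℕ} (α : Fin (m + 1) → Fin n) :
    ww R α = ∑ μ : Fin (m + 1), (-1 : R) ^ (μ : ℕ) • mon R (List.ofFn (α ∘ μ.succAbove)) := by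
  induction m with
  | zero =>
    simp [ww, mon_cons, mon_nil, DD_gen_mul, DD_one, dU_single]
    rw [← mul_one (gaGen _), DD_gen_mul]
    simp [DD_one, dU_single]
  | succ m ih =>
    rw [Fin.sum_univ_succ, ww, List.ofFn_succ, mon_cons, DD_gen_mul, dU_single]
    have := ih (α ∘ Fin.succ)
    rw [ww] at this
    simp only [Function.comp_def] at this
    rw [this, Finset.mul_sum]
    simp only [Finset.mem_univ, if_true, one_smul, Fin.val_zero, pow_zero, Function.comp_def,
      Fin.succAbove_zero, sub_eq_add_neg, ← Finset.sum_neg_distrib]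
    congr 1
    refine Finset.sum_congr rfl fun μ _ => ?_
    rw [List.ofFn_succ (n := m), mon_cons]
    simp [pow_succ]

end helpers2

section helpers3

set_option linter.unusedSectionVars false

variable {n : ℕ}

/-- block element with coefficient -/
def FF {R : Type*} [CommRing R] {n : ℕ} (y : ∀ k : ℕ, (Fin k → Fin n) → R)
    (a : Σ k : ℕ, Fin k → Fin n) : GA R (Fin n) := y a.1 a.2 • ww R a.2

/-- standard ordering of a block -/
def blk {n : ℕ} (A : Finset (Fin n)) : Σ k : ℕ, Fin k → Fin n :=
  ⟨A.card, A.orderEmbOfFin rfl⟩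

lemma blk_inj (A : Finset (Fin n)) : Function.Injective (blk A).2 :=
  (A.orderEmbOfFin rfl).injective

lemma blk_image (A : Finset (Fin n)) : Finset.image (blk A).2 Finset.univ = A := by
  apply Finset.coe_injective
  rw [Finset.coe_image, Finset.coe_univ, Set.image_univ]
  exact Finset.range_orderEmbOfFin A rfl

lemma image_perm {k : ℕ} (β : Fin k → Fin n) (σ : Equiv.Perm (Fin k)) :
    Finset.image (β ∘ σ) Finset.univ = Finset.image β Finset.univ := by
  rw [← Finset.image_image, Finset.image_univ_equiv]

lemma exists_perm {k : ℕ} (α β : Fin k → Fin n) (hα : Function.Injective α)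
    (h : Finset.image α Finset.univ = Finset.image β Finset.univ) :
    ∃ σ : Equiv.Perm (Fin k), α = β ∘ σ := by
  have h1 : ∀ t, ∃ s, β s = α t := fun t => by
    have : α t ∈ Finset.image β Finset.univ := h ▸ Finset.mem_image_of_mem _ (Finset.mem_univ _)
    simpa using this
  choose s hs using h1
  have hinj : Function.Injective s := fun a b hab => hα (by rw [← hs, ← hs, hab])
  refine ⟨Equiv.ofBijective s (Finite.injective_iff_bijective.1 hinj), ?_⟩
  ext t
  simp [hs]

lemma sign_sq' {k : ℕ} (σ : Equiv.Perm (Fin k)) :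
    ((Equiv.Perm.sign σ : ℤ) : R) * ((Equiv.Perm.sign σ : ℤ) : R) = 1 := by
  rcases Int.units_eq_one_or (Equiv.Perm.sign σ) with h | h <;> simp [h]

lemma FF_perm (y : ∀ k : ℕ, (Fin k → Fin n) → R)
    (hy : ∀ (k : ℕ) (σ : Equiv.Perm (Fin k)) (α : Fin k → Fin n),
      y k (α ∘ σ) = ((Equiv.Perm.sign σ : ℤ) : R) * y k α) {k : ℕ} (α : Fin k → Fin n)
    (σ : Equiv.Perm (Fin k)) : FF y ⟨k, α ∘ σ⟩ = FF y ⟨k, α⟩ := by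
  simp only [FF]
  rw [hy, ww_perm, smul_smul, mul_right_comm, sign_sq', one_mul]

lemma FF_congr (y : ∀ k : ℕ, (Fin k → Fin n) → R)
    (hy : ∀ (k : ℕ) (σ : Equiv.Perm (Fin k)) (α : Fin k → Fin n),
      y k (α ∘ σ) = ((Equiv.Perm.sign σ : ℤ) : R) * y k α) (a b : Σ k : ℕ, Fin k → Fin n)
    (ha : Function.Injective a.2) (hb : Function.Injective b.2)
    (h : Finset.image a.2 Finset.univ = Finset.image b.2 Finset.univ) : FF y a = FF y b := by
  obtain ⟨k, α⟩ := a
  obtain ⟨k', β⟩ := b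
  have hk : k = k' := by
    have := congrArg Finset.card h
    rw [Finset.card_image_of_injective _ ha, Finset.card_image_of_injective _ hb] at this
    simpa using this
  subst hk
  obtain ⟨σ, rfl⟩ := exists_perm α β ha h
  exact FF_perm y hy β σ

lemma sum_FF (y : ∀ k : ℕ, (Fin k → Fin n) → R)
    (hy : ∀ (k : ℕ) (σ : Equiv.Perm (Fin k)) (α : Fin k → Fin n),
      y k (α ∘ σ) = ((Equiv.Perm.sign σ : ℤ) : R) * y k α) (k : ℕ) :
    ∑ α : Fin k → Fin n, FF y ⟨k, α⟩ =
      k.factorial • ∑ A ∈ Finset.powersetCard k (Finset.univ : Finset (Fin n)), FF y (blk A) := by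
  have h1 : ∑ α : Fin k → Fin n, FF y ⟨k, α⟩ =
      ∑ α ∈ Finset.univ.filter (fun α : Fin k → Fin n => Function.Injective α), FF y ⟨k, α⟩ := by
    symm
    apply Finset.sum_subset (Finset.subset_univ _)
    intro α _ hα
    have : ¬ Function.Injective α := by simpa using hα
    simp only [FF]
    rw [ww_not_inj α this, smul_zero]
  rw [h1, ← Finset.sum_fiberwise_of_maps_to (g := fun α => Finset.image α Finset.univ)
    (t := Finset.powersetCard k (Finset.univ : Finset (Fin n))), Finset.smul_sum]
  · refine Finset.sum_congr rfl fun A hA => ?_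
    have hAk : A.card = k := (Finset.mem_powersetCard.1 hA).2
    subst hAk
    rw [Finset.sum_congr rfl (g := fun _ => FF y (blk A)), Finset.sum_const]
    · congr 1
      have := Fintype.card_perm (α := Fin A.card)
      rw [Fintype.card_fin, ← Finset.card_univ] at this
      rw [← this]
      symm
      apply Finset.card_bij (fun (σ : Equiv.Perm (Fin A.card)) _ => (blk A).2 ∘ σ)
      · intro σ _
        simp only [Finset.mem_filter, Finset.mem_univ, true_and]
        refine ⟨(blk_inj A).comp σ.injective, ?_⟩
        exact (image_perm (blk A).2 σ).trans (blk_image A)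
      · intro σ _ τ _ hst
        ext t
        exact congrArg Fin.val (blk_inj A (congrFun hst t))
      · intro α hα
        simp only [Finset.mem_filter, Finset.mem_univ, true_and] at hα
        obtain ⟨σ, hσ⟩ := exists_perm α (blk A).2 hα.1 (by rw [hα.2]; exact (blk_image A).symm)
        exact ⟨σ, Finset.mem_univ _, hσ.symm⟩
    · intro α hα
      simp only [Finset.mem_filter, Finset.mem_univ, true_and] at hα
      exact FF_congr y hy _ _ hα.1 (blk_inj A) (by rw [blk_image]; exact hα.2)
  · intro α hα
    have : Function.Injective α := by simpa using hα
    rw [Finset.mem_powersetCard]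
    exact ⟨Finset.subset_univ _, by rw [Finset.card_image_of_injective _ this]; simp⟩

lemma sum_tail (y : ∀ k : ℕ, (Fin k → Fin n) → R)
    (hy : ∀ (k : ℕ) (σ : Equiv.Perm (Fin k)) (α : Fin k → Fin n),
      y k (α ∘ σ) = ((Equiv.Perm.sign σ : ℤ) : R) * y k α) (m : ℕ) :
    ∑ α : Fin (m + 1) → Fin n, FF y ⟨m + 1, α⟩ =
      (m + 1) • ∑ α : Fin (m + 1) → Fin n, y (m + 1) α • mon R (List.ofFn (α ∘ Fin.succ)) := by
  simp only [FF]
  simp_rw [ww_sum, Finset.smul_sum]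
  rw [Finset.sum_comm, ← Finset.smul_sum]
  have : ∀ μ : Fin (m + 1), ∑ α : Fin (m + 1) → Fin n,
      y (m + 1) α • (-1 : R) ^ (μ : ℕ) • mon R (List.ofFn (α ∘ μ.succAbove)) =
      ∑ α : Fin (m + 1) → Fin n, y (m + 1) α • mon R (List.ofFn (α ∘ Fin.succ)) := by
    intro μ
    rw [← Equiv.sum_comp (Equiv.arrowCongr μ.cycleRange (Equiv.refl (Fin n)))
      (fun α => y (m + 1) α • mon R (List.ofFn (α ∘ Fin.succ)))]
    refine Finset.sum_congr rfl fun α _ => ?_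
    have e1 : (Equiv.arrowCongr μ.cycleRange (Equiv.refl (Fin n))) α = α ∘ μ.cycleRange.symm := rfl
    rw [e1, hy]
    have e2 : (α ∘ μ.cycleRange.symm) ∘ Fin.succ = α ∘ μ.succAbove := by
      ext t; simp
    rw [e2, smul_smul, mul_comm]
    congr 2
    rw [Equiv.Perm.sign_symm, Fin.sign_cycleRange]
    simp
  rw [Finset.sum_congr rfl (fun μ _ => this μ)]
  simp

/-- The set of odd blocks. -/
def TT (n : ℕ) : Finset (Finset (Fin n)) :=
  Finset.univ.filter (fun A => Odd A.card ∧ 3 ≤ A.card)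

lemma tail_lt (k : ℕ) (t : Fin (k - 1)) : (t : ℕ) + 1 < k := by omega

lemma S_eq (y : ∀ k : ℕ, (Fin k → Fin n) → R)
    (hy : ∀ (k : ℕ) (σ : Equiv.Perm (Fin k)) (α : Fin k → Fin n),
      y k (α ∘ σ) = ((Equiv.Perm.sign σ : ℤ) : R) * y k α) :
    (∑ k ∈ Finset.range (n + 1),
          if Odd k ∧ 3 ≤ k then
            algebraMap ℚ R ((k - 1).factorial : ℚ)⁻¹ •
              ∑ α : Fin k → Fin n, y k α •
                (List.ofFn (fun t : Fin (k - 1) =>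
                  (gaGen (α ⟨(t : ℕ) + 1, tail_lt k t⟩) : GA R (Fin n)))).prod
          else 0) = ∑ A ∈ TT n, FF y (blk A) := by
  rw [← Finset.sum_fiberwise_of_maps_to (s := TT n) (g := Finset.card)
    (t := Finset.range (n + 1))]
  · refine Finset.sum_congr rfl fun k _ => ?_
    split_ifs with hk
    · obtain ⟨m, rfl⟩ : ∃ m, k = m + 1 := ⟨k - 1, by omega⟩
      have e1 : (TT n).filter (fun A => A.card = m + 1) =
          Finset.powersetCard (m + 1) (Finset.univ : Finset (Fin n)) := by
        ext A
        simp only [TT, Finset.mem_filter, Finset.mem_univ, true_and, Finset.mem_powersetCard,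
          Finset.subset_univ]
        constructor
        · exact fun h => h.2
        · intro h; rw [h]; exact ⟨hk, rfl⟩
      rw [e1]
      have h1 := sum_FF y hy (m + 1)
      rw [sum_tail y hy m, Nat.factorial_succ, mul_smul] at h1
      have h2 : (∑ α : Fin (m + 1) → Fin n, y (m + 1) α •
                (List.ofFn (fun t : Fin (m + 1 - 1) =>
                  (gaGen (α ⟨(t : ℕ) + 1, by omega⟩) : GA R (Fin n)))).prod) =
          ∑ α : Fin (m + 1) → Fin n, y (m + 1) α • mon R (List.ofFn (α ∘ Fin.succ)) := by
        refine Finset.sum_congr rfl fun α _ => ?_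
        congr 1
        rw [mon, List.map_ofFn]
        rfl
      rw [h2]
      set X := ∑ α : Fin (m + 1) → Fin n, y (m + 1) α • mon R (List.ofFn (α ∘ Fin.succ))
      set W := ∑ A ∈ Finset.powersetCard (m + 1) (Finset.univ : Finset (Fin n)), FF y (blk A)
      have key : ∀ (p : ℕ), p ≠ 0 → ∀ Z : GA R (Fin n),
          algebraMap ℚ R ((p : ℚ)⁻¹) • (p • Z) = Z := by
        intro p hp Z
        rw [← Nat.cast_smul_eq_nsmul R, smul_smul, ← map_natCast (algebraMap ℚ R), ← map_mul,
          inv_mul_cancel₀ (by exact_mod_cast hp), map_one, one_smul]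
      have h3 : X = m.factorial • W := by
        rw [← key (m + 1) (by omega) X, h1, key (m + 1) (by omega)]
      rw [h3, Nat.add_sub_cancel, key _ (Nat.factorial_ne_zero m)]
    · symm
      apply Finset.sum_eq_zero
      intro A hA
      simp only [TT, Finset.mem_filter, Finset.mem_univ, true_and] at hA
      exact absurd (hA.2 ▸ hA.1) hk
  · intro A _
    have := Finset.card_le_univ A
    simp at this ⊢
    omega

lemma add_pow_sq_zero {Z : Type*} [CommRing Z] (a b : Z) (h : a * a = 0) (p : ℕ) :
    (a + b) ^ (p + 1) = b ^ (p + 1) + (p + 1) * (a * b ^ p) := by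
  induction p with
  | zero => simp; ring
  | succ p ih =>
    rw [pow_succ, ih]
    push_cast
    linear_combination (p + 1) * b ^ p * h

lemma sum_pow_sq_zero {Z ι : Type*} [CommRing Z] (t : ι → Z) (T : Finset ι)
    (h : ∀ A ∈ T, t A * t A = 0) (p : ℕ) :
    (∑ A ∈ T, t A) ^ p = (p.factorial : Z) * ∑ U ∈ Finset.powersetCard p T, ∏ A ∈ U, t A := by
  induction T using Finset.induction_on generalizing p with
  | empty =>
    cases p with
    | zero => simp
    | succ p => rw [Finset.powersetCard_eq_empty.2 (by simp)]; simp
  | insert x T hx ih =>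
    cases p with
    | zero => simp
    | succ p =>
      have ih' := ih (fun A hA => h A (Finset.mem_insert_of_mem hA))
      rw [Finset.sum_insert hx, add_pow_sq_zero _ _ (h x (Finset.mem_insert_self _ _)), ih', ih',
        Finset.powersetCard_succ_insert hx, Finset.sum_union, Finset.sum_image]
      · have : ∑ U ∈ Finset.powersetCard p T, ∏ A ∈ insert x U, t A =
            t x * ∑ U ∈ Finset.powersetCard p T, ∏ A ∈ U, t A := by
          rw [Finset.mul_sum]
          refine Finset.sum_congr rfl fun U hU => ?_
          rw [Finset.prod_insert]
          exact fun hxU => hx ((Finset.mem_powersetCard.1 hU).1 hxU)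
        rw [this, Nat.factorial_succ]
        push_cast
        ring
      · intro U hU V hV hUV
        have h1 : x ∉ U := fun hxU => hx ((Finset.mem_powersetCard.1 hU).1 hxU)
        have h2 : x ∉ V := fun hxU => hx ((Finset.mem_powersetCard.1 hV).1 hxU)
        rw [← Finset.erase_insert h1, ← Finset.erase_insert h2]
        exact congrArg (fun W => Finset.erase W x) hUV
      · rw [Finset.disjoint_left]
        intro U hU hU'
        obtain ⟨V, _, rfl⟩ := Finset.mem_image.1 hU'
        exact hx ((Finset.mem_powersetCard.1 hU).1 (Finset.mem_insert_self _ _))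

/-- lift to the center -/
def liftZ {R : Type*} [CommRing R] {n : ℕ} (x : GA R (Fin n)) :
    Subalgebra.center R (GA R (Fin n)) :=
  if h : x ∈ Subalgebra.center R (GA R (Fin n)) then ⟨x, h⟩ else 0

lemma liftZ_coe {m : ℕ} (hm : Even m) {x : GA R (Fin n)} (hx : x ∈ HH R n m) :
    ((liftZ x : Subalgebra.center R (GA R (Fin n))) : GA R (Fin n)) = x := by
  have : x ∈ Subalgebra.center R (GA R (Fin n)) :=
    Subalgebra.mem_center_iff.2 fun z => (HH_comm hm hx z).symm
  simp [liftZ, this]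

lemma FF_mem (y : ∀ k : ℕ, (Fin k → Fin n) → R) (a : Σ k : ℕ, Fin k → Fin n) (ha : Odd a.1) :
    FF y a ∈ HH R n (a.1 - 1) :=
  Submodule.smul_mem _ _ (ww_mem ha _)

lemma even_sub {k : ℕ} (hk : Odd k) : Even (k - 1) := by obtain ⟨m, rfl⟩ := hk; simp

lemma liftZ_FF (y : ∀ k : ℕ, (Fin k → Fin n) → R) (a : Σ k : ℕ, Fin k → Fin n) (ha : Odd a.1) :
    ((liftZ (FF y a) : Subalgebra.center R (GA R (Fin n))) : GA R (Fin n)) = FF y a :=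
  liftZ_coe (even_sub ha) (FF_mem y a ha)

lemma FF_sq (y : ∀ k : ℕ, (Fin k → Fin n) → R) (a : Σ k : ℕ, Fin k → Fin n) (ha : Odd a.1)
    (ha3 : 3 ≤ a.1) : FF y a * FF y a = 0 := by
  simp only [FF]
  rw [smul_mul_assoc, mul_smul_comm, ww_sq ha ha3, smul_zero, smul_zero]

lemma gexp_eq (y : ∀ k : ℕ, (Fin k → Fin n) → R) :
    gexp (∑ A ∈ TT n, FF y (blk A)) =
      ∑ p ∈ Finset.range (n + 1), ∑ 𝒜 ∈ Finset.powersetCard p (TT n),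
        ((∏ A ∈ 𝒜, liftZ (FF y (blk A)) : Subalgebra.center R (GA R (Fin n))) : GA R (Fin n)) := by
  rw [gexp, Fintype.card_fin]
  refine Finset.sum_congr rfl fun p _ => ?_
  have hT : ∀ A ∈ TT n, Odd (blk A).1 ∧ 3 ≤ (blk A).1 := fun A hA => (Finset.mem_filter.1 hA).2
  have h1 : ∑ A ∈ TT n, FF y (blk A) = ((∑ A ∈ TT n, liftZ (FF y (blk A)) :
      Subalgebra.center R (GA R (Fin n))) : GA R (Fin n)) := by
    rw [AddSubmonoidClass.coe_finsetSum]
    exact Finset.sum_congr rfl fun A hA => (liftZ_FF y _ (hT A hA).1).symm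
  rw [h1, ← SubmonoidClass.coe_pow, sum_pow_sq_zero, ← AddSubmonoidClass.coe_finsetSum,
    ← nsmul_eq_mul]
  · rw [AddSubmonoidClass.coe_nsmul, ← Nat.cast_smul_eq_nsmul R, smul_smul,
      ← map_natCast (algebraMap ℚ R), ← map_mul,
          inv_mul_cancel₀ (by exact_mod_cast Nat.factorial_ne_zero p), map_one, one_smul]
  · intro A hA
    apply Subtype.ext
    rw [MulMemClass.coe_mul, liftZ_FF y _ (hT A hA).1, FF_sq y _ (hT A hA).1 (hT A hA).2]
    rfl

end helpers3

section helpers4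

set_option linter.unusedSectionVars false

variable {n : ℕ}

lemma inc_lr (𝒜 : Finset (Finset (Fin n))) (A : {A // A ∈ 𝒜}) (j : Fin n) :
    (incGraph 𝒜).Adj (Sum.inl A) (Sum.inr j) ↔ j ∈ A.1 := by
  simp [incGraph]

lemma inc_ll (𝒜 : Finset (Finset (Fin n))) (A B : {A // A ∈ 𝒜}) :
    ¬ (incGraph 𝒜).Adj (Sum.inl A) (Sum.inl B) := by
  simp [incGraph]

lemma inc_rr (𝒜 : Finset (Finset (Fin n))) (i j : Fin n) :
    ¬ (incGraph 𝒜).Adj (Sum.inr i) (Sum.inr j) := by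
  simp [incGraph]

lemma inc_edges (𝒜 : Finset (Finset (Fin n))) :
    Nat.card (incGraph 𝒜).edgeSet = ∑ A ∈ 𝒜, A.card := by
  have hb : (incGraph 𝒜).IsBipartiteWith
      ((Finset.univ.map Function.Embedding.inl : Finset ({A // A ∈ 𝒜} ⊕ Fin n)) : Set _)
      ((Finset.univ.map Function.Embedding.inr : Finset ({A // A ∈ 𝒜} ⊕ Fin n)) : Set _) := by
    constructor
    · rw [Set.disjoint_left]; rintro (x | x) <;> simp
    · rintro (x | x) (z | z) h
      · exact absurd h (inc_ll _ _ _)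
      · simp
      · simp
      · exact absurd h (inc_rr _ _ _)
  have h := SimpleGraph.isBipartiteWith_sum_degrees_eq_card_edges hb
  rw [Nat.card_eq_fintype_card, ← SimpleGraph.edgeFinset_card, ← h, Finset.sum_map,
    ← Finset.sum_coe_sort 𝒜]
  refine Finset.sum_congr rfl fun A _ => ?_
  rw [← SimpleGraph.card_neighborFinset_eq_degree]
  have : (incGraph 𝒜).neighborFinset (Function.Embedding.inl A) =
      A.1.map Function.Embedding.inr := by
    ext z
    rw [SimpleGraph.mem_neighborFinset]
    rcases z with B | j
    · simp only [Function.Embedding.inl_apply]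
      simpa using inc_ll 𝒜 A B
    · simp only [Function.Embedding.inl_apply, inc_lr]
      simp
  rw [this, Finset.card_map]

lemma tree_iff (𝒜 : Finset (Finset (Fin n))) (h3 : ∀ A ∈ 𝒜, 3 ≤ A.card) :
    (incGraph 𝒜).IsTree ↔ (incGraph 𝒜).Connected ∧ 1 + ∑ A ∈ 𝒜, (A.card - 1) = n := by
  rw [SimpleGraph.isTree_iff_connected_and_card, inc_edges]
  have h1 : ∑ A ∈ 𝒜, A.card = ∑ A ∈ 𝒜, (A.card - 1) + 𝒜.card := by
    rw [Finset.card_eq_sum_ones, ← Finset.sum_add_distrib]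
    refine Finset.sum_congr rfl fun A hA => ?_
    have := h3 A hA
    omega
  have h2 : Nat.card ({A // A ∈ 𝒜} ⊕ Fin n) = 𝒜.card + n := by simp
  rw [h1, h2]
  refine and_congr Iff.rfl ?_
  omega

lemma closer {V : Type*} {G : SimpleGraph V} (hG : G.Connected) {u v : V} (h : u ≠ v) :
    ∃ w, G.Adj u w ∧ G.dist w v < G.dist u v := by
  obtain ⟨p, hp⟩ := hG.exists_walk_length_eq_dist u v
  cases p with
  | nil => exact absurd rfl h
  | cons hadj q =>
    refine ⟨_, hadj, ?_⟩
    have := SimpleGraph.dist_le q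
    rw [SimpleGraph.Walk.length_cons] at hp
    omega

/-- the product attached to a family -/
def PP {R : Type*} [CommRing R] {n : ℕ} (y : ∀ k : ℕ, (Fin k → Fin n) → R)
    (𝒜 : Finset (Finset (Fin n))) : Subalgebra.center R (GA R (Fin n)) :=
  ∏ A ∈ 𝒜, liftZ (FF y (blk A))

lemma PP_mem (y : ∀ k : ℕ, (Fin k → Fin n) → R) (𝒜 : Finset (Finset (Fin n)))
    (h : ∀ A ∈ 𝒜, Odd A.card) :
    (PP y 𝒜 : GA R (Fin n)) ∈ HH R n (∑ A ∈ 𝒜, (A.card - 1)) := by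
  induction 𝒜 using Finset.induction_on with
  | empty =>
    have := mon_mem_HH (R := R) ([] : List (Fin n))
    simpa [PP, mon_nil] using this
  | insert A 𝒜 hA ih =>
    have hA1 : Odd A.card := h A (by simp)
    rw [PP, Finset.prod_insert hA, Finset.sum_insert hA, MulMemClass.coe_mul,
      liftZ_FF y (blk A) hA1]
    exact HH_mul (FF_mem y (blk A) hA1) (ih fun B hB => h B (by simp [hB]))

lemma PP_DD (y : ∀ k : ℕ, (Fin k → Fin n) → R) (𝒜 : Finset (Finset (Fin n)))
    (h : ∀ A ∈ 𝒜, Odd A.card) (U : Finset (Fin n))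
    (hU : ∀ A ∈ 𝒜, (∀ i ∈ A, i ∈ U) ∨ (∀ i ∈ A, i ∉ U)) :
    DD (dU R U) (PP y 𝒜 : GA R (Fin n)) = 0 := by
  induction 𝒜 using Finset.induction_on with
  | empty => simp [PP, DD_one]
  | insert A 𝒜 hA ih =>
    have hA1 : Odd A.card := h A (by simp)
    have e := ih (fun B hB => h B (by simp [hB])) (fun B hB => hU B (by simp [hB]))
    rw [PP] at e
    have hb : ∀ t, (blk A).2 t ∈ A := fun t =>
      (blk_image A).subset (Finset.mem_image_of_mem _ (Finset.mem_univ t))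
    rw [PP, Finset.prod_insert hA, MulMemClass.coe_mul, liftZ_FF y (blk A) hA1,
      HH_leibniz (even_sub hA1) (FF_mem y (blk A) hA1), e, mul_zero, add_zero, FF, map_smul, DD_ww,
      smul_zero, zero_mul]
    rcases hU A (by simp) with h1 | h1
    · exact Or.inl fun t => h1 _ (hb t)
    · exact Or.inr fun t => h1 _ (hb t)

lemma top_root (y : ∀ k : ℕ, (Fin k → Fin n) → R) (𝒜 : Finset (Finset (Fin n)))
    (h : ∀ A ∈ 𝒜, Odd A.card) (i j : Fin n) :
    top R (gaGen i * (PP y 𝒜 : GA R (Fin n))) = top R (gaGen j * (PP y 𝒜 : GA R (Fin n))) := by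
  have h1 := top_DD (dU R Finset.univ) (gaGen i * (gaGen j * (PP y 𝒜 : GA R (Fin n))))
  rw [DD_gen_mul, DD_gen_mul, PP_DD y 𝒜 h _ (fun A _ => Or.inl fun i _ => Finset.mem_univ i),
    dU_single, dU_single] at h1
  simp only [Finset.mem_univ, if_true, one_smul, mul_zero, sub_zero, map_sub] at h1
  exact (sub_eq_zero.1 h1).symm

lemma top_not_cactus (y : ∀ k : ℕ, (Fin k → Fin n) → R) (𝒜 : Finset (Finset (Fin n)))
    (h : ∀ A ∈ 𝒜, Odd A.card ∧ 3 ≤ A.card) (i : Fin n) (hc : ¬ IsCactus 𝒜) :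
    top R (gaGen i * (PP y 𝒜 : GA R (Fin n))) = 0 := by
  have hodd : ∀ A ∈ 𝒜, Odd A.card := fun A hA => (h A hA).1
  have hnt : ¬ (incGraph 𝒜).IsTree := fun ht => hc ⟨h, ht⟩
  rw [tree_iff 𝒜 (fun A hA => (h A hA).2)] at hnt
  by_cases hconn : (incGraph 𝒜).Connected
  · have hne : 1 + ∑ A ∈ 𝒜, (A.card - 1) ≠ n := fun e => hnt ⟨hconn, e⟩
    have h1 : (gaGen i : GA R (Fin n)) ∈ HH R n 1 := by
      have := mon_mem_HH (R := R) [i]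
      rwa [mon_cons, mon_nil, mul_one] at this
    exact HH_top hne (HH_mul h1 (PP_mem y 𝒜 hodd))
  · let U : Finset (Fin n) :=
      Finset.univ.filter (fun v => ¬ (incGraph 𝒜).Reachable (Sum.inr i) (Sum.inr v))
    have hU : ∀ v, v ∈ U ↔ ¬ (incGraph 𝒜).Reachable (Sum.inr i) (Sum.inr v) := by simp [U]
    have hAr : ∀ (A : {A // A ∈ 𝒜}) (v : Fin n), v ∈ A.1 →
        ((incGraph 𝒜).Reachable (Sum.inr i) (Sum.inr v) ↔
          (incGraph 𝒜).Reachable (Sum.inr i) (Sum.inl A)) := by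
      intro A v hv
      have := ((inc_lr 𝒜 A v).2 hv).reachable
      exact ⟨fun h => h.trans this.symm, fun h => h.trans this⟩
    have hne : ∃ u, u ∈ U := by
      by_contra! hcon
      apply hconn
      rw [SimpleGraph.connected_iff_exists_forall_reachable]
      refine ⟨Sum.inr i, ?_⟩
      rintro (A | v)
      · have hA3 := (h A.1 A.2).2
        obtain ⟨v, hv⟩ : A.1.Nonempty := Finset.card_pos.1 (by omega)
        rw [← hAr A v hv]
        have := hcon v
        rw [hU] at this
        exact not_not.1 this
      · have := hcon v
        rw [hU] at this
        exact not_not.1 this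
    obtain ⟨u, hu⟩ := hne
    have hi : i ∉ U := by rw [hU]; exact fun h => h (SimpleGraph.Reachable.refl _)
    have hP := PP_DD y 𝒜 hodd U (by
      intro A hA
      by_cases hr : (incGraph 𝒜).Reachable (Sum.inr i) (Sum.inl ⟨A, hA⟩)
      · right
        intro v hv
        rw [hU, not_not]
        exact (hAr ⟨A, hA⟩ v hv).2 hr
      · left
        intro v hv
        rw [hU]
        exact fun hh => hr ((hAr ⟨A, hA⟩ v hv).1 hh))
    have h1 := top_DD (dU R U) (gaGen u * (gaGen i * (PP y 𝒜 : GA R (Fin n))))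
    rw [DD_gen_mul, DD_gen_mul, hP, dU_single, dU_single, if_pos hu, if_neg hi] at h1
    simpa using h1

lemma mem_circ {k : ℕ} (α : Fin k → Fin n) (μ : Fin k) (v : Fin n)
    (hv : v ∈ Finset.image α Finset.univ) (hne : v ≠ α μ) : v ∈ circ α μ := by
  have h1 : v ∈ (List.ofFn α).rotate μ := by
    rw [List.mem_rotate, List.mem_ofFn']
    simpa using hv
  rw [circ_rotate] at h1
  simpa [hne] using h1

lemma circ_length {k : ℕ} (α : Fin k → Fin n) (μ : Fin k) : (circ α μ).length = k - 1 := by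
  simp [circ]

lemma list_prod_mon {X : Type*} (L : List X) (c : X → R) (l : X → List (Fin n)) :
    (L.map (fun x => c x • mon R (l x))).prod = (L.map c).prod • mon R (L.map l).flatten := by
  induction L with
  | nil => simp [mon_nil]
  | cons x L ih =>
    simp only [List.map_cons, List.prod_cons, List.flatten_cons]
    rw [ih, mon_append, smul_mul_assoc, mul_smul_comm, smul_smul]

lemma exists_refined (𝒜 : Finset (Finset (Fin n))) (hc : IsCactus 𝒜) (i : Fin n) :
    ∃ (C : Finset (Σ k : ℕ, Fin k → Fin n)) (pl : List (Fin n)),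
      RefinedCactus C ∧ cactusOf C = 𝒜 ∧ IsCactusList C i pl := by
  have hcC : cactusOf (𝒜.image blk) = 𝒜 := by
    rw [cactusOf, Finset.image_image]
    conv_rhs => rw [← Finset.image_id (s := 𝒜)]
    exact Finset.image_congr fun A _ => blk_image A
  have hex : ∀ A, ∃ l, A ∈ 𝒜 → IsCirculation 𝒜 i (blk A) l := by
    intro A
    by_cases hA : A ∈ 𝒜
    · have hA' : Finset.image (blk A).2 Finset.univ ∈ 𝒜 := by rwa [blk_image]
      obtain ⟨w, hw, hd⟩ := closer hc.2.1 (u := Sum.inl ⟨_, hA'⟩) (v := Sum.inr i) (by simp)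
      rcases w with B | j
      · exact absurd hw (inc_ll _ _ _)
      · rw [inc_lr] at hw
        obtain ⟨μ, _, rfl⟩ := Finset.mem_image.1 hw
        exact ⟨circ (blk A).2 μ, fun _ => ⟨μ, hA', hd, rfl⟩⟩
    · exact ⟨[], fun h => absurd h hA⟩
  choose l hl using hex
  have hblk : Function.Injective (blk : Finset (Fin n) → _) := fun A B h => by
    rw [← blk_image A, ← blk_image B, h]
  refine ⟨𝒜.image blk, i :: ((𝒜.toList.map (fun A => (blk A, l A))).map Prod.snd).flatten,
    ⟨?_, ?_, ?_⟩, hcC, 𝒜.toList.map (fun A => (blk A, l A)), ?_, ?_, ?_, rfl⟩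
  · intro a ha
    obtain ⟨A, hA, rfl⟩ := Finset.mem_image.1 ha
    exact ⟨(hc.1 A hA).1, (hc.1 A hA).2, blk_inj A⟩
  · intro a ha b hb hab
    obtain ⟨A, hA, rfl⟩ := Finset.mem_image.1 (Finset.mem_coe.1 ha)
    obtain ⟨B, hB, rfl⟩ := Finset.mem_image.1 (Finset.mem_coe.1 hb)
    simp only [blk_image] at hab
    rw [hab]
  · rwa [hcC]
  · rw [List.map_map]
    exact (Finset.nodup_toList 𝒜).map hblk
  · ext a
    simp
  · intro x hx
    obtain ⟨A, hA, rfl⟩ := List.mem_map.1 hx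
    rw [hcC]
    exact hl A (Finset.mem_toList.1 hA)

lemma top_value (y : ∀ k : ℕ, (Fin k → Fin n) → R)
    (hy : ∀ (k : ℕ) (σ : Equiv.Perm (Fin k)) (α : Fin k → Fin n),
      y k (α ∘ σ) = ((Equiv.Perm.sign σ : ℤ) : R) * y k α)
    (C : Finset (Σ k : ℕ, Fin k → Fin n)) (i : Fin n) (pl : List (Fin n))
    (hC : RefinedCactus C) (hpl : IsCactusList C i pl) :
    top R (gaGen i * (PP y (cactusOf C) : GA R (Fin n))) =
      ((Equiv.Perm.sign (listPerm pl) : ℤ) : R) * ∏ a ∈ C, y a.1 a.2 := by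
  obtain ⟨L, hnd, hLC, hcirc, rfl⟩ := hpl
  obtain ⟨hC1, hC2, hC3, htree⟩ := hC
  have hLnd : L.Nodup := List.Nodup.of_map _ hnd
  have hconn := htree.1
  have hmemC : ∀ x ∈ L, x.1 ∈ C := fun x hx => by
    rw [← hLC, List.mem_toFinset]; exact List.mem_map_of_mem hx
  let img : (Σ k : ℕ, Fin k → Fin n) → Finset (Fin n) := fun a => Finset.image a.2 Finset.univ
  let δ : (Σ k : ℕ, Fin k → Fin n) × List (Fin n) → ℕ := fun x =>
    if h : img x.1 ∈ cactusOf C then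
      (incGraph (cactusOf C)).dist (Sum.inl ⟨_, h⟩) (Sum.inr i) else 0
  let ε : Fin n → ℕ := fun v => (incGraph (cactusOf C)).dist (Sum.inr v) (Sum.inr i)
  have hloc : ∀ x ∈ L, ∃ μ : Fin x.1.1, x.2 = circ x.1.2 μ ∧ ε (x.1.2 μ) < δ x := by
    intro x hx
    obtain ⟨μ, hA, hd, hl⟩ := hcirc x hx
    refine ⟨μ, hl, ?_⟩
    simp only [δ, ε, img, dif_pos hA]
    exact hd
  have hW : ∀ v, v ≠ i → ∃ x ∈ L, v ∈ x.2 ∧ δ x < ε v := by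
    intro v hv
    obtain ⟨w, hw, hd⟩ := closer hconn (u := Sum.inr v) (v := Sum.inr i) (by simpa using hv)
    rcases w with ⟨B, hB⟩ | j
    · rw [SimpleGraph.adj_comm, inc_lr] at hw
      obtain ⟨a, ha, rfl⟩ := Finset.mem_image.1 hB
      rw [← hLC, List.mem_toFinset] at ha
      obtain ⟨x, hx, rfl⟩ := List.mem_map.1 ha
      have hδ : δ x < ε v := by
        simp only [δ, ε, img, dif_pos hB]
        exact hd
      obtain ⟨μ, h1, h2⟩ := hloc x hx
      refine ⟨x, hx, ?_, hδ⟩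
      rw [h1]
      refine mem_circ _ _ _ hw ?_
      rintro rfl
      omega
    · exact absurd hw (inc_rr _ _ _)
  -- products
  have hP1 : PP y (cactusOf C) = ∏ x ∈ L.toFinset, liftZ (FF y x.1) := by
    rw [PP, cactusOf, Finset.prod_image hC2, List.prod_toFinset _ hLnd]
    have : ∏ a ∈ C, liftZ (FF y (blk (Finset.image a.2 Finset.univ))) =
        ∏ a ∈ C, liftZ (FF y a) := by
      refine Finset.prod_congr rfl fun a ha => ?_
      rw [FF_congr y hy _ a (blk_inj _) (hC1 a ha).2.2 (blk_image _)]
    rw [this, ← hLC, List.prod_toFinset _ hnd, List.map_map]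
    rfl
  have hFc : ∀ x ∈ L, ((liftZ (FF y x.1) : Subalgebra.center R (GA R (Fin n))) : GA R (Fin n))
      = FF y x.1 := fun x hx => liftZ_FF y _ (hC1 _ (hmemC x hx)).1
  have hMc : ∀ x ∈ L, ((liftZ (y x.1.1 x.1.2 • mon R x.2) :
      Subalgebra.center R (GA R (Fin n))) : GA R (Fin n)) = y x.1.1 x.1.2 • mon R x.2 := by
    intro x hx
    obtain ⟨μ, h1, h2⟩ := hloc x hx
    refine liftZ_coe (even_sub (hC1 _ (hmemC x hx)).1) ?_
    apply Submodule.smul_mem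
    have := mon_mem_HH (R := R) x.2
    rw [h1, circ_length] at this
    rw [h1]
    exact this
  have key : ∀ s : Finset ((Σ k : ℕ, Fin k → Fin n) × List (Fin n)), s ⊆ L.toFinset →
      (∀ a ∈ s, ∀ b ∈ L, δ b < δ a → b ∈ s) →
      gaGen i * ((∏ x ∈ s, liftZ (FF y x.1) : Subalgebra.center R (GA R (Fin n))) : GA R (Fin n)) =
      gaGen i * ((∏ x ∈ s, liftZ (y x.1.1 x.1.2 • mon R x.2) :
        Subalgebra.center R (GA R (Fin n))) : GA R (Fin n)) := by
    intro s
    induction s using Finset.induction_on_max_value δ with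
    | empty => intro _ _; rfl
    | insert a s has hmax ih =>
      intro hsub hdown
      have haL : a ∈ L := List.mem_toFinset.1 (hsub (Finset.mem_insert_self _ _))
      have hs : s ⊆ L.toFinset := fun b hb => hsub (Finset.mem_insert_of_mem hb)
      have ih' := ih hs (fun b hb c hcL hlt => by
        have h1 := hmax b hb
        have := hdown a (Finset.mem_insert_self _ _) c hcL (by omega)
        rcases Finset.mem_insert.1 this with rfl | h
        · omega
        · exact h)
      obtain ⟨μ, h1, h2⟩ := hloc a haL
      have hao := (hC1 _ (hmemC a haL)).1
      rw [Finset.prod_insert has, Finset.prod_insert has, mul_comm, MulMemClass.coe_mul,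
        ← mul_assoc, ih', mul_assoc, ← MulMemClass.coe_mul]
      by_cases hr : a.1.2 μ = i
      · rw [mul_comm, MulMemClass.coe_mul, MulMemClass.coe_mul, ← mul_assoc, ← mul_assoc,
          hFc a haL, hMc a haL, FF, mul_smul_comm, mul_smul_comm, h1, ← hr, gen_mul_ww hao]
      · obtain ⟨b, hbL, hvb, hlt⟩ := hW _ hr
        have hbs : b ∈ s := by
          have := hdown a (Finset.mem_insert_self _ _) b hbL (by omega)
          rcases Finset.mem_insert.1 this with rfl | h
          · omega
          · exact h
        have hz : liftZ (y b.1.1 b.1.2 • mon R b.2) * liftZ (FF y a.1) =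
            liftZ (y b.1.1 b.1.2 • mon R b.2) * liftZ (y a.1.1 a.1.2 • mon R a.2) := by
          apply Subtype.ext
          rw [MulMemClass.coe_mul, MulMemClass.coe_mul, hFc a haL, hMc a haL, hMc b hbL, FF,
            smul_mul_assoc, smul_mul_assoc, mul_smul_comm, mul_smul_comm, mon_mul_ww hao _ μ _ hvb,
            ← h1]
        rw [← Finset.mul_prod_erase s _ hbs, mul_right_comm, hz]
        congr 2
        ring
  have hlen : (i :: (L.map Prod.snd).flatten).length = n := by
    have h3 := ((tree_iff (cactusOf C) (fun A hA => (hC3 A hA).2)).1 htree).2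
    have e1 : ∑ A ∈ cactusOf C, (A.card - 1) = (L.map (fun x => x.1.1 - 1)).sum := by
      rw [cactusOf, Finset.sum_image hC2]
      have : ∑ a ∈ C, ((Finset.image a.2 Finset.univ).card - 1) = ∑ a ∈ C, (a.1 - 1) := by
        refine Finset.sum_congr rfl fun a ha => ?_
        rw [Finset.card_image_of_injective _ (hC1 a ha).2.2]
        simp
      rw [this, ← hLC, List.sum_toFinset _ hnd, List.map_map]
      rfl
    have e2 : L.map (fun x => x.1.1 - 1) = L.map (fun x => x.2.length) := by
      apply List.map_congr_left
      intro x hx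
      obtain ⟨μ, h1, h2⟩ := hloc x hx
      rw [h1, circ_length]
    rw [List.length_cons, List.length_flatten, List.map_map]
    have e3 : (L.map (List.length ∘ Prod.snd)).sum = (L.map (fun x => x.1.1 - 1)).sum := by
      rw [e2]; rfl
    rw [e3, ← e1]
    omega
  have hnod : (i :: (L.map Prod.snd).flatten).Nodup := by
    have hu : (i :: (L.map Prod.snd).flatten).toFinset = Finset.univ := by
      ext v
      simp only [List.mem_toFinset, Finset.mem_univ, iff_true, List.mem_cons]
      by_cases hv : v = i
      · exact Or.inl hv
      · right
        obtain ⟨x, hx, hvx, _⟩ := hW v hv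
        exact List.mem_flatten.2 ⟨x.2, List.mem_map_of_mem hx, hvx⟩
    have hcard := congrArg Finset.card hu
    rw [List.card_toFinset, Finset.card_univ, Fintype.card_fin] at hcard
    rw [← List.dedup_eq_self]
    exact (List.dedup_sublist _).eq_of_length (by rw [hcard, hlen])
  rw [hP1, key _ (Finset.Subset.refl _) (fun a _ b hb _ => List.mem_toFinset.2 hb),
    List.prod_toFinset _ hLnd]
  have hcoe : (((L.map (fun x => liftZ (y x.1.1 x.1.2 • mon R x.2))).prod :
      Subalgebra.center R (GA R (Fin n))) : GA R (Fin n)) =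
      (L.map (fun x => y x.1.1 x.1.2)).prod • mon R (L.map Prod.snd).flatten := by
    rw [← list_prod_mon, SubmonoidClass.coe_list_prod, List.map_map]
    congr 1
    exact List.map_congr_left hMc
  rw [hcoe, mul_smul_comm, ← mon_cons, map_smul, top_mon _ hlen hnod, smul_eq_mul, mul_comm]
  congr 1
  rw [← hLC, List.prod_toFinset _ hnd, List.map_map]
  rfl

lemma top_cactus (y : ∀ k : ℕ, (Fin k → Fin n) → R)
    (hy : ∀ (k : ℕ) (σ : Equiv.Perm (Fin k)) (α : Fin k → Fin n),
      y k (α ∘ σ) = ((Equiv.Perm.sign σ : ℤ) : R) * y k α)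
    (𝒜 : Finset (Finset (Fin n))) (hc : IsCactus 𝒜) (i : Fin n) :
    top R (gaGen i * (PP y 𝒜 : GA R (Fin n))) = cactusAmp y 𝒜 := by
  have h : ∃ x : Finset (Σ k : ℕ, Fin k → Fin n) × Fin n × List (Fin n),
      RefinedCactus x.1 ∧ cactusOf x.1 = 𝒜 ∧ IsCactusList x.1 x.2.1 x.2.2 := by
    obtain ⟨C, pl, h⟩ := exists_refined 𝒜 hc i
    exact ⟨(C, i, pl), h⟩
  rw [cactusAmp, dif_pos h]
  obtain ⟨h1, h2, h3⟩ := h.choose_spec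
  rw [← top_value y hy _ _ _ h1 h3, h2]
  exact top_root y 𝒜 (fun A hA => (hc.1 A hA).1) _ _

lemma main_eq (y : ∀ k : ℕ, (Fin k → Fin n) → R)
    (hy : ∀ (k : ℕ) (σ : Equiv.Perm (Fin k)) (α : Fin k → Fin n),
      y k (α ∘ σ) = ((Equiv.Perm.sign σ : ℤ) : R) * y k α) (i : Fin n) :
    top R (gaGen i * gexp (∑ A ∈ TT n, FF y (blk A))) =
      ∑ 𝒜 ∈ Finset.univ.filter (fun 𝒜 : Finset (Finset (Fin n)) => IsCactus 𝒜),
        cactusAmp y 𝒜 := by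
  rw [gexp_eq, Finset.mul_sum, map_sum]
  have hT : ∀ A ∈ TT n, Odd A.card ∧ 3 ≤ A.card := fun A hA => (Finset.mem_filter.1 hA).2
  have h1 : ∀ p, top R (gaGen i * ∑ 𝒜 ∈ Finset.powersetCard p (TT n),
      ((∏ A ∈ 𝒜, liftZ (FF y (blk A)) : Subalgebra.center R (GA R (Fin n))) : GA R (Fin n))) =
      ∑ 𝒜 ∈ (Finset.univ.filter (fun 𝒜 : Finset (Finset (Fin n)) => IsCactus 𝒜)).filter
        (fun 𝒜 => 𝒜.card = p), cactusAmp y 𝒜 := by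
    intro p
    rw [Finset.mul_sum, map_sum]
    symm
    apply Finset.sum_subset_zero_on_sdiff
    · intro 𝒜 h𝒜
      simp only [Finset.mem_filter, Finset.mem_univ, true_and] at h𝒜
      rw [Finset.mem_powersetCard]
      exact ⟨fun A hA => Finset.mem_filter.2 ⟨Finset.mem_univ _, h𝒜.1.1 A hA⟩, h𝒜.2⟩
    · intro 𝒜 h𝒜
      rw [Finset.mem_sdiff, Finset.mem_powersetCard] at h𝒜
      refine top_not_cactus y 𝒜 (fun A hA => hT A (h𝒜.1.1 hA)) i fun hc => h𝒜.2 ?_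
      simp only [Finset.mem_filter, Finset.mem_univ, true_and]
      exact ⟨hc, h𝒜.1.2⟩
    · intro 𝒜 h𝒜
      simp only [Finset.mem_filter, Finset.mem_univ, true_and] at h𝒜
      exact (top_cactus y hy 𝒜 h𝒜.1 i).symm
  rw [Finset.sum_congr rfl fun p _ => h1 p]
  apply Finset.sum_fiberwise_of_maps_to
  intro 𝒜 h𝒜
  have hc : IsCactus 𝒜 := by simpa using h𝒜
  have h2 := ((tree_iff 𝒜 (fun A hA => (hc.1 A hA).2)).1 hc.2).2
  have h3 : 𝒜.card ≤ ∑ A ∈ 𝒜, (A.card - 1) := by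
    rw [Finset.card_eq_sum_ones]
    apply Finset.sum_le_sum
    intro A hA
    have := (hc.1 A hA).2
    omega
  rw [Finset.mem_range]
  omega

end helpers4

/-- The hyperpfaffian-cactus theorem: for `n` odd and completely antisymmetric tensors
`y^[k]` for each odd `3 ≤ k ≤ n`, the Berezin integral
`∫ dχ_n ⋯ dχ_1 χ_i exp(Σ_k (1/(k-1)!) Σ_α y^[k]_α χ_{α₂}⋯χ_{α_k})`
is independent of `i` and equals the sum of the amplitudes of all odd cacti. -/
theorem hyperpfaffian_cactus (n : ℕ) (hn : Odd n)
    (y : ∀ k : ℕ, (Fin k → Fin n) → R)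
    (hy : ∀ (k : ℕ) (σ : Equiv.Perm (Fin k)) (α : Fin k → Fin n),
      y k (α ∘ σ) = ((Equiv.Perm.sign σ : ℤ) : R) * y k α) :
    (∀ i j : Fin n,
      gaCoef (bint ((List.ofFn (id : Fin n → Fin n)).reverse)
        ((gaGen i : GA R (Fin n)) * gexp (∑ k ∈ Finset.range (n + 1),
          if Odd k ∧ 3 ≤ k then
            algebraMap ℚ R ((k - 1).factorial : ℚ)⁻¹ •
              ∑ α : Fin k → Fin n, y k α •
                (List.ofFn (fun t : Fin (k - 1) =>
                  (gaGen (α ⟨(t : ℕ) + 1, by omega⟩) : GA R (Fin n)))).prod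
          else 0))) =
      gaCoef (bint ((List.ofFn (id : Fin n → Fin n)).reverse)
        ((gaGen j : GA R (Fin n)) * gexp (∑ k ∈ Finset.range (n + 1),
          if Odd k ∧ 3 ≤ k then
            algebraMap ℚ R ((k - 1).factorial : ℚ)⁻¹ •
              ∑ α : Fin k → Fin n, y k α •
                (List.ofFn (fun t : Fin (k - 1) =>
                  (gaGen (α ⟨(t : ℕ) + 1, by omega⟩) : GA R (Fin n)))).prod
          else 0)))) ∧
    ∀ i : Fin n,
      gaCoef (bint ((List.ofFn (id : Fin n → Fin n)).reverse)
        ((gaGen i : GA R (Fin n)) * gexp (∑ k ∈ Finset.range (n + 1),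
          if Odd k ∧ 3 ≤ k then
            algebraMap ℚ R ((k - 1).factorial : ℚ)⁻¹ •
              ∑ α : Fin k → Fin n, y k α •
                (List.ofFn (fun t : Fin (k - 1) =>
                  (gaGen (α ⟨(t : ℕ) + 1, by omega⟩) : GA R (Fin n)))).prod
          else 0))) =
      ∑ 𝒜 ∈ Finset.univ.filter (fun 𝒜 : Finset (Finset (Fin n)) => IsCactus 𝒜),
        cactusAmp y 𝒜 := by
  have key : ∀ i : Fin n,
      gaCoef (bint ((List.ofFn (id : Fin n → Fin n)).reverse)
        ((gaGen i : GA R (Fin n)) * gexp (∑ k ∈ Finset.range (n + 1),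
          if Odd k ∧ 3 ≤ k then
            algebraMap ℚ R ((k - 1).factorial : ℚ)⁻¹ •
              ∑ α : Fin k → Fin n, y k α •
                (List.ofFn (fun t : Fin (k - 1) =>
                  (gaGen (α ⟨(t : ℕ) + 1, by omega⟩) : GA R (Fin n)))).prod
          else 0))) =
      ∑ 𝒜 ∈ Finset.univ.filter (fun 𝒜 : Finset (Finset (Fin n)) => IsCactus 𝒜),
        cactusAmp y 𝒜 := by
    intro i
    rw [S_eq y hy, top_eq]
    exact main_eq y hy i
  exact ⟨fun i j => by rw [key i, key j], key⟩
end
end
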